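/- Suppose Φ is irreducible and not of type G₂. Let Ψ ⊆ Φ⁺ be either a combinatorial ideal or a biconvex subset, and suppose ⟨α,β⟩ ≥ 0 for all α, β ∈ Ψ. Then 𝔞_Ψ = ⊕_{α∈Ψ} 𝔤_α is a spherical subspace of 𝔫, i.e. ad(x)⁴ = 0 for every x ∈ 𝔞_Ψ. -/

import Mathlib

/- Background setup: a finite reduced crystallographic root system `Φ` with chosen
positive roots `Φ⁺` in a euclidean space `V`, the Cartan pairing, and the basic
combinatorial notions used in the statement. -/

open scoped RealInnerProductSpace

noncomputable section

variable {V : Type*} [NormedAddCommGroup V] [InnerProductSpace ℝ V]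

/-- The Cartan pairing `⟨α, β⟩ = 2 (α, β) / (β, β)`. -/
def cpair (α β : V) : ℝ := 2 * ⟪α, β⟫ / ⟪β, β⟫

/-- The reflection associated to `β`, as a linear endomorphism of `V`:
`v ↦ v - (2 (β, v)/(β, β)) • β`. -/
def reflEnd (β : V) : Module.End ℝ V :=
  LinearMap.id -
    (LinearMap.toSpanSingleton ℝ V β ∘ₗ ((2 / ⟪β, β⟫) • (innerSL ℝ β).toLinearMap))

/-- A subset of `V` is orthogonal if the Cartan pairing of any two distinct
elements vanishes. -/
def OrthogonalSet (S : Set V) : Prop := ∀ γ ∈ S, ∀ γ' ∈ S, γ ≠ γ' → cpair γ γ' = 0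

/-- A finite reduced crystallographic root system in the euclidean space `V`,
together with a choice of positive roots. -/
structure RootSystemData (V : Type*) [NormedAddCommGroup V] [InnerProductSpace ℝ V] where
  /-- the set of roots Φ -/
  roots : Set V
  /-- the set of positive roots Φ⁺ -/
  pos : Set V
  finite : roots.Finite
  ne_zero : ∀ α ∈ roots, α ≠ 0
  span_eq_top : Submodule.span ℝ roots = ⊤
  reduced : ∀ α ∈ roots, ∀ t : ℝ, t • α ∈ roots → t = 1 ∨ t = -1
  crystallographic : ∀ α ∈ roots, ∀ β ∈ roots, ∃ n : ℤ, cpair α β = (n : ℝ)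
  reflect_mem : ∀ α ∈ roots, ∀ β ∈ roots, reflEnd β α ∈ roots
  pos_subset : pos ⊆ roots
  pos_iff : ∀ α ∈ roots, (α ∈ pos ↔ ¬ (-α ∈ pos))
  pos_add : ∀ α ∈ pos, ∀ β ∈ pos, α + β ∈ roots → α + β ∈ pos

namespace RootSystemData

variable (D : RootSystemData V)

/-- Irreducibility: the roots admit no nontrivial partition into two mutually
orthogonal parts. -/
def IsIrreducible : Prop :=
  D.roots.Nonempty ∧
    ∀ s ⊆ D.roots, (∀ α ∈ s, ∀ β ∈ D.roots \ s, ⟪α, β⟫ = 0) → s = ∅ ∨ s = D.roots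

/-- An irreducible root system is not of type `G₂` iff no Cartan pairing of two
roots equals `±3`. -/
def NotG2 : Prop := ∀ α ∈ D.roots, ∀ β ∈ D.roots, cpair α β ≠ 3 ∧ cpair α β ≠ -3

/-- An irreducible root system is of type `G₂` iff some Cartan pairing of two
roots equals `±3`. -/
def IsG2 : Prop :=
  D.IsIrreducible ∧ ∃ α ∈ D.roots, ∃ β ∈ D.roots, cpair α β = 3 ∨ cpair α β = -3

/-- All roots have the same length (types A, D, E). -/
def SimplyLaced : Prop := ∀ α ∈ D.roots, ∀ β ∈ D.roots, ⟪α, α⟫ = ⟪β, β⟫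

/-- There are exactly two root lengths, with squared-length ratio 2
(types B, C, F₄). -/
def DoublyLaced : Prop :=
  (∃ α ∈ D.roots, ∃ β ∈ D.roots, ⟪β, β⟫ = 2 * ⟪α, α⟫) ∧
    ∀ α ∈ D.roots, ∀ β ∈ D.roots,
      ⟪α, α⟫ = ⟪β, β⟫ ∨ ⟪β, β⟫ = 2 * ⟪α, α⟫ ∨ ⟪α, α⟫ = 2 * ⟪β, β⟫

/-- A root of maximal length. -/
def IsLong (α : V) : Prop := α ∈ D.roots ∧ ∀ β ∈ D.roots, ⟪β, β⟫ ≤ ⟪α, α⟫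

/-- A root of minimal length. -/
def IsShort (α : V) : Prop := α ∈ D.roots ∧ ∀ β ∈ D.roots, ⟪α, α⟫ ≤ ⟪β, β⟫

/-- A set of positive roots is convex if any root which is a linear combination of
two of its elements with positive coefficients lies in it. -/
def ConvexSubset (S : Set V) : Prop :=
  ∀ α ∈ S, ∀ β ∈ S, ∀ a b : ℝ, 0 < a → 0 < b →
    a • α + b • β ∈ D.roots → a • α + b • β ∈ S

/-- A subset `Ψ ⊆ Φ⁺` is biconvex if both `Ψ` and `Φ⁺ \ Ψ` are convex. -/
def Biconvex (S : Set V) : Prop :=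
  S ⊆ D.pos ∧ D.ConvexSubset S ∧ D.ConvexSubset (D.pos \ S)

/-- A subset `Ψ ⊆ Φ⁺` is a combinatorial ideal if `α ∈ Ψ`, `β ∈ Φ⁺`, `α + β ∈ Φ⁺`
imply `α + β ∈ Ψ`. -/
def CombIdeal (S : Set V) : Prop :=
  S ⊆ D.pos ∧ ∀ α ∈ S, ∀ β ∈ D.pos, α + β ∈ D.pos → α + β ∈ S

end RootSystemData

/- The Lie-theoretic setup: a finite-dimensional complex simple Lie algebra `𝔤`
with Cartan subalgebra `𝔱`, whose root space decomposition is indexed by the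
root system `Φ ⊆ V`. -/

/-- A finite-dimensional simple complex Lie algebra `L`, together with a Cartan
subalgebra and its root space decomposition, whose root system is `Φ ⊆ V` with a
choice of positive roots (determining the Borel subalgebra `𝔟 = 𝔱 ⊕ 𝔫`). -/
structure LieRootData (V : Type*) [NormedAddCommGroup V] [InnerProductSpace ℝ V]
    (L : Type*) [LieRing L] [LieAlgebra ℂ L] extends RootSystemData V where
  /-- the Cartan subalgebra 𝔱 -/
  cartan : LieSubalgebra ℂ L
  /-- the root space 𝔤_α attached to each root α -/
  rs : V → Submodule ℂ L
  finiteDim : FiniteDimensional ℂ L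
  isSimple : LieAlgebra.IsSimple ℂ L
  isCartan : cartan.IsCartanSubalgebra
  rs_dim : ∀ α ∈ roots, Module.finrank ℂ (rs α) = 1
  sup_eq_top : cartan.toSubmodule ⊔ (⨆ α ∈ roots, rs α) = ⊤
  indep : ∀ α ∈ roots, rs α ⊓ (cartan.toSubmodule ⊔ ⨆ β ∈ roots \ {α}, rs β) = ⊥
  weight_vec : ∀ α ∈ roots, ∀ h ∈ cartan, ∀ x ∈ rs α, ∃ c : ℂ, ⁅h, x⁆ = c • x
  bracket_mem : ∀ α ∈ roots, ∀ β ∈ roots, α + β ∈ roots →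
    ∀ x ∈ rs α, ∀ y ∈ rs β, ⁅x, y⁆ ∈ rs (α + β)
  bracket_ne_zero : ∀ α ∈ roots, ∀ β ∈ roots, α + β ∈ roots →
    ∀ x ∈ rs α, x ≠ 0 → ∀ y ∈ rs β, y ≠ 0 → ⁅x, y⁆ ≠ 0
  bracket_eq_zero : ∀ α ∈ roots, ∀ β ∈ roots, α + β ∉ roots → α + β ≠ 0 →
    ∀ x ∈ rs α, ∀ y ∈ rs β, ⁅x, y⁆ = 0
  bracket_cartan_mem : ∀ α ∈ roots, ∀ x ∈ rs α, ∀ y ∈ rs (-α), ⁅x, y⁆ ∈ cartan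

namespace LieRootData

variable {L : Type*} [LieRing L] [LieAlgebra ℂ L] (D : LieRootData V L)

/-- The nilradical `𝔫 = ⊕_{α ∈ Φ⁺} 𝔤_α` of the Borel subalgebra, as a submodule. -/
def nilrad : Submodule ℂ L := ⨆ α ∈ D.pos, D.rs α

/-- The Borel subalgebra `𝔟 = 𝔱 ⊕ 𝔫`, as a submodule. -/
def borel : Submodule ℂ L := D.cartan.toSubmodule ⊔ D.nilrad

/-- The subspace `𝔞_Ψ = ⊕_{α ∈ Ψ} 𝔤_α` attached to a subset `Ψ ⊆ Φ⁺`. -/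
def aSubspace (S : Set V) : Submodule ℂ L := ⨆ α ∈ S, D.rs α

end LieRootData

/-- A subspace of `𝔫` is spherical if `ad(x)^4 = 0` for every `x` in it. -/
def IsSphericalSubspace {L : Type*} [LieRing L] [LieAlgebra ℂ L]
    (a : Submodule ℂ L) : Prop :=
  ∀ x ∈ a, (LieAlgebra.ad ℂ L x) ^ 4 = 0

/-- The height of a nilpotent element `x`: `max {n | ad(x)^n ≠ 0}`. -/
noncomputable def heightOf {L : Type*} [LieRing L] [LieAlgebra ℂ L] (x : L) : ℕ :=
  sSup {n : ℕ | (LieAlgebra.ad ℂ L x) ^ n ≠ 0}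


set_option linter.unusedVariables false

/-! ### Normalised form -/

structure GoodForm (R : Set V) (B : V →ₗ[ℝ] V →ₗ[ℝ] ℝ) : Prop where
  symm : ∀ a b, B a b = B b a
  nonneg : ∀ v, 0 ≤ B v v
  definite : ∀ v, B v v = 0 → v = 0
  len : ∀ a ∈ R, B a a = 2 ∨ B a a = 4
  int : ∀ a ∈ R, ∀ b ∈ R, ∃ n : ℤ, B a b = n
  even : ∀ a ∈ R, ∀ b ∈ R, B a a = 4 → ∃ n : ℤ, B a b = 2 * n
  neg : ∀ a ∈ R, -a ∈ R
  refl_s : ∀ a ∈ R, ∀ b ∈ R, B b b = 2 → a - (B a b) • b ∈ R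
  refl_l : ∀ a ∈ R, ∀ b ∈ R, B b b = 4 → a - (B a b / 2) • b ∈ R

lemma reflEnd_eq (a b : V) : reflEnd b a = a - (2 * ⟪a, b⟫ / ⟪b, b⟫) • b := by
  simp only [reflEnd, LinearMap.sub_apply, LinearMap.id_apply, LinearMap.comp_apply,
    LinearMap.toSpanSingleton_apply, LinearMap.smul_apply]
  congr 2
  simp [real_inner_comm]
  ring

lemma pairlen (D : RootSystemData V) (hG2 : D.NotG2) (a b : V) (ha : a ∈ D.roots)
    (hb : b ∈ D.roots) (hab : ⟪a, b⟫ ≠ 0) :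
    ⟪a, a⟫ = ⟪b, b⟫ ∨ ⟪a, a⟫ = 2 * ⟪b, b⟫ ∨ ⟪b, b⟫ = 2 * ⟪a, a⟫ := by
  obtain ⟨p, hp⟩ := D.crystallographic a ha b hb
  obtain ⟨q, hq⟩ := D.crystallographic b hb a ha
  have h1 := hG2 a ha b hb
  have h2 := hG2 b hb a ha
  have ha0 : 0 < ⟪a, a⟫ := real_inner_self_pos.2 (D.ne_zero a ha)
  have hb0 : 0 < ⟪b, b⟫ := real_inner_self_pos.2 (D.ne_zero b hb)
  rw [hp] at h1
  rw [hq] at h2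
  unfold cpair at hp hq
  rw [real_inner_comm] at hq
  have hp' : 2 * ⟪a, b⟫ = p * ⟪b, b⟫ := by rw [← hp]; field_simp
  have hq' : 2 * ⟪a, b⟫ = q * ⟪a, a⟫ := by rw [← hq]; field_simp
  have hcs := real_inner_mul_inner_self_le a b
  have hA : 0 < ⟪a, a⟫ * ⟪b, b⟫ := mul_pos ha0 hb0
  have hpq : (p * q : ℝ) * (⟪a, a⟫ * ⟪b, b⟫) = 4 * (⟪a, b⟫ * ⟪a, b⟫) := by
    have : (p * ⟪b, b⟫) * (q * ⟪a, a⟫) = (2 * ⟪a, b⟫) * (2 * ⟪a, b⟫) := by rw [← hp', ← hq']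
    linarith
  have hle : (p * q : ℝ) ≤ 4 := by
    by_contra h
    push Not at h
    nlinarith
  have hpos : (0 : ℝ) < p * q := by
    by_contra h
    push Not at h
    have : 0 < ⟪a, b⟫ * ⟪a, b⟫ := mul_self_pos.2 hab
    nlinarith
  have hle' : p * q ≤ 4 := by exact_mod_cast hle
  have hpos' : 0 < p * q := by exact_mod_cast hpos
  have h3 : p ≠ 3 ∧ p ≠ -3 ∧ q ≠ 3 ∧ q ≠ -3 := by
    refine ⟨?_, ?_, ?_, ?_⟩ <;> rintro rfl <;> simp at h1 h2
  have hfour : p * q = 4 → p = 2 ∨ p = -2 := by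
    intro h4
    have h4' : (p * q : ℝ) = 4 := by exact_mod_cast h4
    have hw : (2 : ℝ) • a - (p : ℝ) • b = 0 := by
      rw [← inner_self_eq_zero (𝕜 := ℝ)]
      simp only [inner_sub_left, inner_sub_right, real_inner_smul_left, real_inner_smul_right,
        real_inner_comm a b]
      have : (p : ℝ) * (p * ⟪b, b⟫) = p * (q * ⟪a, a⟫) := by rw [← hp', ← hq']
      have e2 : (p : ℝ) * (q * ⟪a, a⟫) = 4 * ⟪a, a⟫ := by rw [← mul_assoc, h4']
      have e3 : (p : ℝ) * (2 * ⟪a, b⟫) = p * (q * ⟪a, a⟫) := by rw [hq']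
      linarith
    have hab' : a = ((p : ℝ) / 2) • b := by
      have : (2 : ℝ) • a = (p : ℝ) • b := sub_eq_zero.1 hw
      rw [div_eq_inv_mul, mul_smul, ← this, smul_smul]; norm_num
    rcases D.reduced b hb _ (hab' ▸ ha) with h | h
    · left; have : (p : ℝ) = 2 := by linarith
      exact_mod_cast this
    · right; have : (p : ℝ) = -2 := by linarith
      exact_mod_cast this
  have hk : (p : ℝ) * ⟪b, b⟫ = q * ⟪a, a⟫ := by rw [← hp', ← hq']
  have hpb : -4 ≤ p ∧ p ≤ 4 := by
    rcases lt_trichotomy q 0 with h | h | h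
    · constructor <;> nlinarith
    · simp [h] at hpos'
    · constructor <;> nlinarith
  have hqb : -4 ≤ q ∧ q ≤ 4 := by
    rcases lt_trichotomy p 0 with h | h | h
    · constructor <;> nlinarith
    · simp [h] at hpos'
    · constructor <;> nlinarith
  have key : p = q ∨ 2 * p = q ∨ p = 2 * q := by
    obtain ⟨h5, h6⟩ := hpb
    obtain ⟨h7, h8⟩ := hqb
    clear hk hab hpos hle hpq hcs hA hp' hq' hp hq h1 h2
    interval_cases p <;> interval_cases q <;> simp_all
  have hp0 : (p : ℝ) ≠ 0 := fun h => by simp [h] at hpos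
  have hq0 : (q : ℝ) ≠ 0 := fun h => by simp [h] at hpos
  rcases key with h | h | h
  · left; subst h; exact (mul_left_cancel₀ hp0 hk).symm
  · right; right; subst h; push_cast at hk
    apply mul_left_cancel₀ hp0; linarith
  · right; left; subst h; push_cast at hk
    apply mul_left_cancel₀ hq0; linarith

lemma exists_nonorth (D : RootSystemData V) (hirr : D.IsIrreducible) (a b : V)
    (ha : a ∈ D.roots) (hb : b ∈ D.roots) :
    ∃ a' ∈ D.roots, ⟪a', a'⟫ = ⟪a, a⟫ ∧ ⟪a', b⟫ ≠ 0 := by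
  by_contra hcon
  push Not at hcon
  have h := hirr.2 {x | x ∈ D.roots ∧ ∀ a' ∈ D.roots, ⟪a', a'⟫ = ⟪a, a⟫ → ⟪a', x⟫ = 0}
    (fun x hx => hx.1) ?_
  · rcases h with h | h
    · have : b ∈ (∅ : Set V) := by rw [← h]; exact ⟨hb, hcon⟩
      exact this
    · have : a ∈ D.roots := ha
      rw [← h] at this
      have := this.2 a ha rfl
      exact D.ne_zero a ha (inner_self_eq_zero.1 this)
  · rintro x ⟨hx, hx'⟩ y ⟨hy, hy'⟩
    simp only [Set.mem_ofPred_eq, not_and, not_forall] at hy'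
    obtain ⟨a', ha', hl, hne⟩ := hy' hy
    have hm := D.reflect_mem a' ha' y hy
    have hy0 : ⟪y, y⟫ ≠ 0 := inner_self_ne_zero.2 (D.ne_zero y hy)
    rw [reflEnd_eq] at hm
    have h1 := hx' _ hm (by
      simp only [inner_sub_left, inner_sub_right, real_inner_smul_left, real_inner_smul_right, hl,
        real_inner_comm a' y]
      field_simp
      ring)
    have h2 := hx' a' ha' hl
    rw [inner_sub_left, h2, inner_smul_left] at h1
    simp at h1
    rw [real_inner_comm]
    rcases h1 with (h1 | h1) | h1
    · exact absurd h1 hne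
    · exact absurd h1 (D.ne_zero y hy)
    · exact h1

lemma exists_goodForm (D : RootSystemData V) (hirr : D.IsIrreducible) (hG2 : D.NotG2) :
    ∃ c : ℝ, 0 < c ∧ GoodForm D.roots (c • innerₗ V) := by
  obtain ⟨m, hm, hmin⟩ := Set.exists_min_image D.roots (fun x => ⟪x, x⟫) D.finite hirr.1
  have hm0 : 0 < ⟪m, m⟫ := real_inner_self_pos.2 (D.ne_zero m hm)
  have hlen : ∀ a ∈ D.roots, ⟪a, a⟫ = ⟪m, m⟫ ∨ ⟪a, a⟫ = 2 * ⟪m, m⟫ := by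
    intro a ha
    obtain ⟨a', ha', hl, hne⟩ := exists_nonorth D hirr a m ha hm
    have h1 := pairlen D hG2 a' m ha' hm hne
    have h2 := hmin a ha
    rw [hl] at h1
    rcases h1 with h | h | h
    · exact Or.inl h
    · exact Or.inr h
    · linarith
  have hval : ∀ a b : V, ((2 / ⟪m, m⟫) • innerₗ V) a b = 2 * ⟪a, b⟫ / ⟪m, m⟫ := by
    intro a b
    simp
    ring
  have hrefl : ∀ a ∈ D.roots, ∀ b ∈ D.roots, a - (2 * ⟪a, b⟫ / ⟪b, b⟫) • b ∈ D.roots := by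
    intro a ha b hb
    rw [← reflEnd_eq]; exact D.reflect_mem a ha b hb
  refine ⟨2 / ⟪m, m⟫, by positivity, ?_⟩
  have hl4 : ∀ a ∈ D.roots, ((2 / ⟪m, m⟫) • innerₗ V) a a = 4 → ⟪a, a⟫ = 2 * ⟪m, m⟫ := by
    intro a ha h
    rw [hval] at h
    field_simp at h
    linarith
  have hl2 : ∀ a ∈ D.roots, ((2 / ⟪m, m⟫) • innerₗ V) a a = 2 → ⟪a, a⟫ = ⟪m, m⟫ := by
    intro a ha h
    rw [hval] at h
    field_simp at h
    linarith
  constructor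
  · intro a b; rw [hval, hval, real_inner_comm]
  · intro v; rw [hval]; have := real_inner_self_nonneg (x := v); positivity
  · intro v hv
    rw [hval] at hv
    have : ⟪v, v⟫ = 0 := by field_simp at hv; linarith
    exact inner_self_eq_zero.1 this
  · intro a ha
    rw [hval]
    rcases hlen a ha with h | h <;> rw [h]
    · left; field_simp
    · right; field_simp; norm_num
  · intro a ha b hb
    rw [hval]
    obtain ⟨n, hn⟩ := D.crystallographic a ha b hb
    unfold cpair at hn
    rcases hlen b hb with h | h <;> rw [h] at hn
    · exact ⟨n, hn⟩
    · refine ⟨2 * n, ?_⟩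
      push_cast
      rw [← hn]; field_simp
  · intro a ha b hb h4
    rw [hval]
    obtain ⟨n, hn⟩ := D.crystallographic b hb a ha
    unfold cpair at hn
    rw [hl4 a ha h4, real_inner_comm] at hn
    refine ⟨n, ?_⟩
    rw [← hn]; field_simp
  · intro a ha
    have := hrefl a ha a ha
    have ha0 : ⟪a, a⟫ ≠ 0 := inner_self_ne_zero.2 (D.ne_zero a ha)
    rw [mul_div_assoc, div_self ha0, mul_one, two_smul] at this
    simpa using this
  · intro a ha b hb h
    have := hrefl a ha b hb
    rw [hl2 b hb h] at this
    rw [hval]; exact this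
  · intro a ha b hb h
    have := hrefl a ha b hb
    rw [hl4 b hb h] at this
    rw [hval]
    convert this using 3
    field_simp

/-! ### Consequences of the normalised form -/

section GoodFormLemmas

variable {R : Set V} {B : V →ₗ[ℝ] V →ₗ[ℝ] ℝ}

/-- integer value of the form -/
def bz (B : V →ₗ[ℝ] V →ₗ[ℝ] ℝ) (a b : V) : ℤ := ⌊B a b⌋

lemma bz_cast (H : GoodForm R B) {a b : V} (ha : a ∈ R) (hb : b ∈ R) :
    (bz B a b : ℝ) = B a b := by
  obtain ⟨n, hn⟩ := H.int a ha b hb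
  simp [bz, hn]

lemma bz_symm (H : GoodForm R B) (a b : V) : bz B a b = bz B b a := by
  simp [bz, H.symm a b]

lemma bz_len (H : GoodForm R B) {a : V} (ha : a ∈ R) : bz B a a = 2 ∨ bz B a a = 4 := by
  have h := bz_cast H ha ha
  rcases H.len a ha with h' | h' <;> rw [h'] at h
  · left; exact_mod_cast h
  · right; exact_mod_cast h

lemma form_bound (H : GoodForm R B) (a b : V) :
    -(B a a + B b b) ≤ 2 * B a b ∧ 2 * B a b ≤ B a a + B b b := by
  have h1 := H.nonneg (a + b)
  have h2 := H.nonneg (a - b)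
  simp only [map_add, map_sub, LinearMap.add_apply, LinearMap.sub_apply, H.symm b a] at h1 h2
  constructor <;> linarith

lemma bz_bound (H : GoodForm R B) {a b : V} (ha : a ∈ R) (hb : b ∈ R) :
    -(bz B a a + bz B b b) ≤ 2 * bz B a b ∧ 2 * bz B a b ≤ bz B a a + bz B b b := by
  have h := form_bound H a b
  rw [← bz_cast H ha ha, ← bz_cast H hb hb, ← bz_cast H ha hb] at h
  exact_mod_cast h

lemma bz_even (H : GoodForm R B) {a b : V} (ha : a ∈ R) (hb : b ∈ R) (h4 : bz B a a = 4) :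
    ∃ n : ℤ, bz B a b = 2 * n := by
  have h := bz_cast H ha ha
  rw [h4] at h
  obtain ⟨n, hn⟩ := H.even a ha b hb (by rw [← h]; norm_num)
  refine ⟨n, ?_⟩
  rw [← bz_cast H ha hb] at hn
  exact_mod_cast hn

lemma bz_eq (H : GoodForm R B) {a b : V} (ha : a ∈ R) (hb : b ∈ R)
    (h : 2 * bz B a b = bz B a a + bz B b b) : a = b := by
  have h' : 2 * B a b = B a a + B b b := by
    rw [← bz_cast H ha ha, ← bz_cast H hb hb, ← bz_cast H ha hb]
    exact_mod_cast h
  have : a - b = 0 := H.definite _ (by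
    simp only [map_sub, LinearMap.sub_apply, H.symm b a]; linarith)
  exact sub_eq_zero.1 this

lemma root_sub (H : GoodForm R B) {a b : V} (ha : a ∈ R) (hb : b ∈ R) (hab : 0 < B a b)
    (hne : a ≠ b) : a - b ∈ R := by
  have h0 : 0 < bz B a b := by
    rw [← bz_cast H ha hb] at hab; exact_mod_cast hab
  have hbd := bz_bound H ha hb
  have hne' : 2 * bz B a b ≠ bz B a a + bz B b b := fun h => hne (bz_eq H ha hb h)
  have cb := bz_cast H ha hb
  have ca := bz_cast H ha ha
  have cbb := bz_cast H hb hb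
  have hs := H.symm a b
  rcases bz_len H ha with hla | hla <;> rcases bz_len H hb with hlb | hlb
  · have : bz B a b = 1 := by omega
    have h := H.refl_s a ha b hb (by rw [← cbb, hlb]; norm_num)
    rw [← cb, this] at h; simpa using h
  · obtain ⟨n, hn⟩ := bz_even H hb ha hlb
    rw [bz_symm H] at hn
    have : bz B a b = 2 := by omega
    have h := H.refl_l a ha b hb (by rw [← cbb, hlb]; norm_num)
    rw [← cb, this] at h; simpa using h
  · obtain ⟨n, hn⟩ := bz_even H ha hb hla
    have : bz B a b = 2 := by omega
    have h := H.refl_l b hb a ha (by rw [← ca, hla]; norm_num)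
    rw [← hs, ← cb, this] at h
    have h2 := H.neg _ h
    simpa using h2
  · obtain ⟨n, hn⟩ := bz_even H ha hb hla
    have : bz B a b = 2 := by omega
    have h := H.refl_l a ha b hb (by rw [← cbb, hlb]; norm_num)
    rw [← cb, this] at h; simpa using h

lemma root_add (H : GoodForm R B) {a b : V} (ha : a ∈ R) (hb : b ∈ R) (hab : B a b < 0)
    (hne : a + b ≠ 0) : a + b ∈ R := by
  have h := root_sub H ha (H.neg b hb) (by rw [map_neg]; linarith)
    (fun h => hne (by rw [h]; simp))
  simpa using h

lemma root_ne_zero (H : GoodForm R B) {a : V} (ha : a ∈ R) : a ≠ 0 := by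
  rintro rfl
  rcases H.len 0 ha with h | h <;> simp at h

/-- A vector whose norm is not `2` or `4` is not a root. -/
lemma not_root (H : GoodForm R B) {a : V} (h : 4 < B a a) : a ∉ R := by
  intro ha
  rcases H.len a ha with h' | h' <;> linarith

end GoodFormLemmas

lemma exists_phi (D : RootSystemData V) {B : V →ₗ[ℝ] V →ₗ[ℝ] ℝ} (H : GoodForm D.roots B) :
    ∃ φ : V →ₗ[ℝ] ℝ, ∀ a ∈ D.roots, (a ∈ D.pos ↔ 0 < φ a) ∧ φ a ≠ 0 := by
  classical
  have hfin : D.pos.Finite := D.finite.subset D.pos_subset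
  obtain ⟨P, hP⟩ : ∃ P : Finset V, ∀ x, x ∈ P ↔ x ∈ D.pos := ⟨hfin.toFinset, by simp⟩
  have key : ∀ a ∈ D.pos, 0 < ∑ b ∈ P, B b a := by
    intro a ha
    have haR := D.pos_subset ha
    have ha0 : 0 < B a a := by rcases H.len a haR with h | h <;> rw [h] <;> norm_num
    -- the reflection
    let r : V → V := fun b => b - (2 * B b a / B a a) • a
    have hrB : ∀ b, B (r b) a = - B b a := by
      intro b
      simp only [r, map_sub, map_smul, LinearMap.sub_apply, LinearMap.smul_apply, smul_eq_mul]
      field_simp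
      ring
    have hrr : ∀ b, r (r b) = b := by
      intro b
      have : r (r b) = r b - (2 * B (r b) a / B a a) • a := rfl
      rw [this, hrB]
      simp only [r]
      rw [sub_sub, ← add_smul]
      have : 2 * B b a / B a a + 2 * -B b a / B a a = 0 := by ring
      rw [this]; simp
    have hrpos : ∀ b ∈ D.pos, B b a < 0 → r b ∈ D.pos := by
      intro b hb hneg
      have hbR := D.pos_subset hb
      have hne : b + a ≠ 0 := by
        intro h
        have : b = -a := eq_neg_of_add_eq_zero_left h
        rw [this] at hb
        exact (D.pos_iff a haR).1 ha hb
      have h1 : b + a ∈ D.pos := D.pos_add b hb a ha (root_add H hbR haR hneg hne)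
      have cb := bz_cast H hbR haR
      have ca := bz_cast H haR haR
      have hneg' : bz B b a < 0 := by
        rw [← cb] at hneg; exact_mod_cast hneg
      have hbd := bz_bound H hbR haR
      have hR : r b ∈ D.roots := by
        rcases H.len a haR with h | h
        · have := H.refl_s b hbR a haR h
          simp only [r, h]; convert this using 3; ring
        · have := H.refl_l b hbR a haR h
          simp only [r, h]; convert this using 3; ring
      have hne3 : 2 * bz B b a ≠ -(bz B a a + bz B b b) := by
        intro h
        have h' : 2 * B b a = -(B a a + B b b) := by
          rw [← ca, ← cb, ← bz_cast H hbR hbR]; exact_mod_cast h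
        apply hne
        apply H.definite
        simp only [map_add, LinearMap.add_apply, H.symm a b]; linarith
      have hcase : r b = b + a ∨ r b = b + a + a := by
        rcases bz_len H haR with hla | hla
        · rcases bz_len H hbR with hlb | hlb
          · have : bz B b a = -1 := by omega
            left; simp only [r]; rw [← ca, ← cb, this, hla]; push_cast; module
          · obtain ⟨n, hn⟩ := bz_even H hbR haR hlb
            have : bz B b a = -2 := by omega
            right; simp only [r]; rw [← ca, ← cb, this, hla]; push_cast; module
        · obtain ⟨n, hn⟩ := bz_even H haR hbR hla
          rw [bz_symm H] at hn
          have : bz B b a = -2 := by have := bz_len H hbR; omega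
          left; simp only [r]; rw [← ca, ← cb, this, hla]; push_cast; module
      rcases hcase with h | h
      · rw [h]; exact h1
      · rw [h] at hR ⊢; exact D.pos_add _ h1 a ha hR
    have haP : a ∈ P := (hP a).2 ha
    have hsplit := Finset.sum_filter_add_sum_filter_not P (fun b => B b a < 0) (fun b => B b a)
    have hinj : ∑ b ∈ (P.filter (fun b => B b a < 0)).image r, B b a
        = - ∑ b ∈ P.filter (fun b => B b a < 0), B b a := by
      rw [Finset.sum_image]
      · rw [← Finset.sum_neg_distrib]
        exact Finset.sum_congr rfl (fun b _ => hrB b)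
      · intro x _ y _ hxy
        rw [← hrr x, ← hrr y, hxy]
    have hanot : a ∉ (P.filter (fun b => B b a < 0)).image r := by
      intro h
      rw [Finset.mem_image] at h
      obtain ⟨b, hb, hba⟩ := h
      rw [Finset.mem_filter, hP] at hb
      have : b = -a := by
        rw [← hrr b, hba]; simp only [r]
        rw [mul_div_assoc, div_self ha0.ne']; module
      rw [this] at hb
      exact (D.pos_iff a haR).1 ha hb.1
    have hsub : insert a ((P.filter (fun b => B b a < 0)).image r)
        ⊆ P.filter (fun b => ¬ B b a < 0) := by
      intro x hx
      rw [Finset.mem_insert] at hx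
      rw [Finset.mem_filter]
      rcases hx with rfl | hx
      · exact ⟨haP, by linarith⟩
      · rw [Finset.mem_image] at hx
        obtain ⟨b, hb, rfl⟩ := hx
        rw [Finset.mem_filter, hP] at hb
        exact ⟨(hP _).2 (hrpos b hb.1 hb.2), by rw [hrB]; linarith [hb.2]⟩
    have hle := Finset.sum_le_sum_of_subset_of_nonneg (f := fun b => B b a) hsub (by
      intro i hi _
      rw [Finset.mem_filter] at hi
      exact not_lt.1 hi.2)
    rw [Finset.sum_insert hanot, hinj] at hle
    linarith
  refine ⟨B (∑ b ∈ P, b), ?_⟩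
  have hφ : ∀ a, B (∑ b ∈ P, b) a = ∑ b ∈ P, B b a := by
    intro a; simp
  intro a ha
  rw [hφ]
  by_cases hp : a ∈ D.pos
  · have := key a hp
    exact ⟨⟨fun _ => this, fun _ => hp⟩, this.ne'⟩
  · have hn : -a ∈ D.pos := by
      by_contra h
      exact hp ((D.pos_iff a ha).2 h)
    have := key _ hn
    simp only [map_neg, Finset.sum_neg_distrib] at this
    exact ⟨⟨fun h => absurd h hp, fun h => by linarith⟩, by linarith⟩

/-! ### Excluded configurations -/

structure PsiData (R : Set V) (B : V →ₗ[ℝ] V →ₗ[ℝ] ℝ) (φ : V →ₗ[ℝ] ℝ) (Ψ : Set V) : Prop where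
  sub : ∀ a ∈ Ψ, a ∈ R
  pos : ∀ a ∈ Ψ, 0 < φ a
  nz : ∀ a ∈ R, φ a ≠ 0
  nn : ∀ a ∈ Ψ, ∀ b ∈ Ψ, 0 ≤ B a b
  cl : (∀ a ∈ Ψ, ∀ b ∈ R, 0 < φ b → a + b ∈ R → a + b ∈ Ψ) ∨
    (∀ a ∈ Ψ, ∀ b ∈ R, ∀ c ∈ R, 0 < φ b → 0 < φ c → (a = b + c ∨ (2 : ℝ) • a = b + c) →
      b ∈ Ψ ∨ c ∈ Ψ)

section Exclusions

variable {R : Set V} {B : V →ₗ[ℝ] V →ₗ[ℝ] ℝ} {φ : V →ₗ[ℝ] ℝ} {Ψ : Set V}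

lemma root_sub' (H : GoodForm R B) {a b : V} (c : V) (ha : a ∈ R) (hb : b ∈ R) (hc : c = a - b)
    (hab : 0 < B a b) (hlt : 2 * B a b < B a a + B b b) : c ∈ R := by
  rw [hc]
  refine root_sub H ha hb hab ?_
  rintro rfl
  linarith

lemma notA_aux (H : GoodForm R B) (P : PsiData R B φ Ψ) (e1 e2 e3 : V)
    (h11 : B e1 e1 = 2) (h22 : B e2 e2 = 2) (h33 : B e3 e3 = 2)
    (h12 : B e1 e2 = 0) (h13 : B e1 e3 = 0) (h23 : B e2 e3 = 0)
    (hp : e1 + e2 ∈ Ψ) (hm : e1 - e2 ∈ Ψ) (h3 : e3 ∈ Ψ) (hg : e1 + e3 ∈ R) (hφ : 0 < φ e2) :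
    False := by
  have h21 : B e2 e1 = 0 := by rw [H.symm]; exact h12
  have h31 : B e3 e1 = 0 := by rw [H.symm]; exact h13
  have h32 : B e3 e2 = 0 := by rw [H.symm]; exact h23
  have r3 := P.sub _ h3
  have rp := P.sub _ hp
  have ev : ∀ x1 x2 x3 y1 y2 y3 : ℝ, B (x1 • e1 + x2 • e2 + x3 • e3)
      (y1 • e1 + y2 • e2 + y3 • e3) = 2 * (x1 * y1 + x2 * y2 + x3 * y3) := by
    intros
    simp only [map_add, map_smul, LinearMap.add_apply, LinearMap.smul_apply, smul_eq_mul,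
      h11, h22, h33, h12, h13, h23, h21, h31, h32]
    ring
  have r1 : e1 ∈ R := root_sub' H e1 hg r3 (by abel)
    (by simp only [map_add, LinearMap.add_apply, h13, h33]; norm_num)
    (by simp only [map_add, LinearMap.add_apply, h11, h13, h31, h33]; norm_num)
  have r2 : e2 ∈ R := root_sub' H e2 rp r1 (by abel)
    (by simp only [map_add, LinearMap.add_apply, h11, h21]; norm_num)
    (by simp only [map_add, LinearMap.add_apply, h11, h12, h21, h22]; norm_num)
  have r13 : e1 - e3 ∈ R := by
    have := H.refl_s _ hg _ r3 h33
    simp only [map_add, LinearMap.add_apply, h13, h33] at this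
    convert this using 1; module
  have r23 : e2 + e3 ∈ R := root_sub' H _ rp r13 (by abel)
    (by simp only [map_add, map_sub, LinearMap.add_apply, LinearMap.sub_apply, h11, h13, h21, h23];
        norm_num)
    (by simp only [map_add, map_sub, LinearMap.add_apply, LinearMap.sub_apply, h11, h13, h21, h23,
          h12, h22, h31, h33]; norm_num)
  have r23' : e2 - e3 ∈ R := root_sub' H _ rp hg (by abel)
    (by simp only [map_add, map_sub, LinearMap.add_apply, LinearMap.sub_apply, h11, h13, h21, h23];
        norm_num)
    (by simp only [map_add, map_sub, LinearMap.add_apply, LinearMap.sub_apply, h11, h13, h21, h23,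
          h12, h22, h31, h33]; norm_num)
  have n23 : e2 + e3 ∉ Ψ := by
    intro h
    have := P.nn _ h _ hm
    simp only [map_add, map_sub, LinearMap.add_apply, LinearMap.sub_apply, h21, h22, h31, h32] at this
    norm_num at this
  rcases P.cl with hI | hC
  · have := hI _ h3 _ r2 hφ (by rw [add_comm]; exact r23)
    rw [add_comm] at this
    exact n23 this
  · rcases lt_or_gt_of_ne (P.nz _ r23') with h | h
    · have r32 := H.neg _ r23'
      rw [neg_sub] at r32
      rcases hC _ h3 _ r32 _ r2 (by simp only [map_sub] at h ⊢; linarith) hφ (Or.inl (by abel))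
        with h' | h'
      · have := P.nn _ h' _ hp
        simp only [map_add, map_sub, LinearMap.add_apply, LinearMap.sub_apply, h21, h22, h31, h32]
          at this
        norm_num at this
      · have := P.nn _ h' _ hm
        simp only [map_add, map_sub, LinearMap.add_apply, LinearMap.sub_apply, h21, h22, h31, h32]
          at this
        norm_num at this
    · have p1 := P.pos _ hm
      have p3 := P.pos _ h3
      simp only [map_sub] at h p1
      rcases hC _ hp _ r13 _ r23 (by simp only [map_sub]; linarith)
        (by simp only [map_add]; linarith) (Or.inl (by abel)) with h' | h'
      · have := P.nn _ h' _ h3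
        simp only [map_add, map_sub, LinearMap.add_apply, LinearMap.sub_apply, h13, h33]
          at this
        norm_num at this
      · exact n23 h'

lemma notA (H : GoodForm R B) (P : PsiData R B φ Ψ) (l1 l2 s g : V)
    (h11 : B l1 l1 = 4) (h22 : B l2 l2 = 4) (h33 : B s s = 2)
    (h12 : B l1 l2 = 0) (h13 : B l1 s = 0) (h23 : B l2 s = 0)
    (hp : l1 ∈ Ψ) (hm : l2 ∈ Ψ) (h3 : s ∈ Ψ) (hg : g ∈ R)
    (hgs : (2 : ℝ) • g = l1 + l2 + (2 : ℝ) • s) : False := by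
  have h21 : B l2 l1 = 0 := by rw [H.symm]; exact h12
  obtain ⟨e1, he1⟩ : ∃ e1, e1 = (1 / 2 : ℝ) • (l1 + l2) := ⟨_, rfl⟩
  obtain ⟨e2, he2⟩ : ∃ e2, e2 = (1 / 2 : ℝ) • (l1 - l2) := ⟨_, rfl⟩
  have t11 : B e1 e1 = 2 := by
    simp only [he1, map_add, map_smul, LinearMap.add_apply, LinearMap.smul_apply, smul_eq_mul,
      h11, h22, h12, h21]; norm_num
  have t22 : B e2 e2 = 2 := by
    simp only [he2, map_sub, map_smul, LinearMap.sub_apply, LinearMap.smul_apply, smul_eq_mul,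
      h11, h22, h12, h21]; norm_num
  have t12 : B e1 e2 = 0 := by
    simp only [he1, he2, map_sub, map_add, LinearMap.add_apply, map_smul, LinearMap.sub_apply,
      LinearMap.smul_apply, smul_eq_mul, h11, h22, h12, h21]; norm_num
  have t13 : B e1 s = 0 := by
    simp only [he1, map_add, map_smul, LinearMap.add_apply, LinearMap.smul_apply, smul_eq_mul,
      h13, h23]; norm_num
  have t23 : B e2 s = 0 := by
    simp only [he2, map_sub, map_smul, LinearMap.sub_apply, LinearMap.smul_apply, smul_eq_mul,
      h13, h23]; norm_num
  have q1 : e1 + e2 = l1 := by rw [he1, he2]; module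
  have q2 : e1 - e2 = l2 := by rw [he1, he2]; module
  have q3 : e1 + s = g := by
    have : g = (1 / 2 : ℝ) • ((2 : ℝ) • g) := by module
    rw [this, hgs, he1]; module
  have r2 : e2 ∈ R := by
    have r1 : e1 ∈ R := root_sub' H e1 hg (P.sub _ h3) (by rw [← q3]; abel)
      (by rw [← q3]; simp only [map_add, LinearMap.add_apply, t13, h33]; norm_num)
      (by rw [← q3]; simp only [map_add, LinearMap.add_apply, t11, t13, H.symm s e1, h33]; norm_num)
    exact root_sub' H e2 (P.sub _ hp) r1 (by rw [← q1]; abel)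
      (by rw [← q1]; simp only [map_add, LinearMap.add_apply, t11, H.symm e2 e1, t12]; norm_num)
      (by rw [← q1]; simp only [map_add, LinearMap.add_apply, t11, t12, t22, H.symm e2 e1]; norm_num)
  rcases lt_or_gt_of_ne (P.nz _ r2) with h | h
  · exact notA_aux H P e1 (-e2) s t11 (by simpa using t22) h33 (by simpa using t12) t13
      (by simpa using t23) (by rw [← sub_eq_add_neg, q2]; exact hm)
      (by rw [sub_neg_eq_add, q1]; exact hp) h3 (q3 ▸ hg) (by rw [map_neg]; linarith)
  · exact notA_aux H P e1 e2 s t11 t22 h33 t12 t13 t23 (q1 ▸ hp) (q2 ▸ hm) h3 (q3 ▸ hg) h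

lemma notD4 (H : GoodForm R B) (P : PsiData R B φ Ψ) (m : ℝ) (hm : 0 < m) (a1 a2 a3 a4 g : V)
    (h11 : B a1 a1 = m) (h22 : B a2 a2 = m) (h33 : B a3 a3 = m) (h44 : B a4 a4 = m)
    (h12 : B a1 a2 = 0) (h13 : B a1 a3 = 0) (h14 : B a1 a4 = 0)
    (h23 : B a2 a3 = 0) (h24 : B a2 a4 = 0) (h34 : B a3 a4 = 0)
    (p1 : a1 ∈ Ψ) (p2 : a2 ∈ Ψ) (p3 : a3 ∈ Ψ) (p4 : a4 ∈ Ψ) (hg : g ∈ R)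
    (hgs : (2 : ℝ) • g = a1 + a2 + a3 + a4) : False := by
  -- reduce to the case where `a1 + a2 - g` is positive
  have main : ∀ a1 a2 a3 a4 : V, B a1 a1 = m → B a2 a2 = m → B a3 a3 = m → B a4 a4 = m →
      B a1 a2 = 0 → B a1 a3 = 0 → B a1 a4 = 0 → B a2 a3 = 0 → B a2 a4 = 0 → B a3 a4 = 0 →
      a1 ∈ Ψ → a2 ∈ Ψ → a3 ∈ Ψ → a4 ∈ Ψ → (2 : ℝ) • g = a1 + a2 + a3 + a4 →
      a1 + a2 - g ∈ R ∧ (0 < φ (a1 + a2 - g) → False) := by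
    clear h11 h22 h33 h44 h12 h13 h14 h23 h24 h34 p1 p2 p3 p4 hgs a1 a2 a3 a4
    intro a1 a2 a3 a4 h11 h22 h33 h44 h12 h13 h14 h23 h24 h34 p1 p2 p3 p4 hgs
    have h21 : B a2 a1 = 0 := by rw [H.symm]; exact h12
    have h31 : B a3 a1 = 0 := by rw [H.symm]; exact h13
    have h41 : B a4 a1 = 0 := by rw [H.symm]; exact h14
    have h32 : B a3 a2 = 0 := by rw [H.symm]; exact h23
    have h42 : B a4 a2 = 0 := by rw [H.symm]; exact h24
    have h43 : B a4 a3 = 0 := by rw [H.symm]; exact h34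
    have gval : ∀ x, 2 * B g x = B a1 x + B a2 x + B a3 x + B a4 x := by
      intro x
      have := congrArg (fun v => B v x) hgs
      simpa using this
    have g1 : B g a1 = m / 2 := by have := gval a1; linarith
    have g2 : B g a2 = m / 2 := by have := gval a2; linarith
    have g3 : B g a3 = m / 2 := by have := gval a3; linarith
    have g4 : B g a4 = m / 2 := by have := gval a4; linarith
    have gg : B g g = m := by
      have := gval g
      rw [H.symm a1, H.symm a2, H.symm a3, H.symm a4, g1, g2, g3, g4] at this
      linarith
    have s1 := H.symm a1 g
    have s2 := H.symm a2 g
    have s3 := H.symm a3 g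
    have s4 := H.symm a4 g
    have t1 : g - a1 ∈ R := root_sub' H _ hg (P.sub _ p1) rfl (by linarith) (by linarith)
    have t2 : g - a2 ∈ R := root_sub' H _ hg (P.sub _ p2) rfl (by linarith) (by linarith)
    have t4 : g - a4 ∈ R := root_sub' H _ hg (P.sub _ p4) rfl (by linarith) (by linarith)
    have rho : a1 + a2 - g ∈ R := root_sub' H _ (P.sub _ p1) t2 (by abel)
      (by simp only [map_sub]; linarith)
      (by simp only [map_sub, LinearMap.sub_apply]; linarith)
    refine ⟨rho, fun hpos => ?_⟩
    have f1 := P.pos _ p1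
    have f2 := P.pos _ p2
    have f3 := P.pos _ p3
    have f4 := P.pos _ p4
    have fg : 2 * φ g = φ a1 + φ a2 + φ a3 + φ a4 := by
      have := congrArg φ hgs
      simpa using this
    rcases P.cl with hI | hC
    · have e : a3 + (a1 + a2 - g) = g - a4 := by
        have : a3 + (a1 + a2 - g) = (a1 + a2 + a3 + a4) - g - a4 := by abel
        rw [this, ← hgs]; module
      have h := hI _ p3 _ rho hpos (by rw [e]; exact t4)
      rw [e] at h
      have := P.nn _ h _ p4
      simp only [map_sub, LinearMap.sub_apply] at this
      linarith
    · have nrho : a1 + a2 - g ∉ Ψ := by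
        intro h
        have := P.nn _ h _ p3
        simp only [map_sub, map_add, LinearMap.add_apply, LinearMap.sub_apply] at this
        linarith
      simp only [map_sub, map_add] at hpos
      have q1 : φ (g - a1) < 0 := by
        by_contra hn
        have hn' := lt_of_le_of_ne (not_lt.1 hn) (P.nz _ t1).symm
        rcases hC _ p2 _ rho _ t1 (by simp only [map_sub, map_add]; linarith) hn'
          (Or.inl (by abel)) with h | h
        · exact nrho h
        · have := P.nn _ h _ p1
          simp only [map_sub, LinearMap.sub_apply] at this
          linarith
      have q2 : φ (g - a2) < 0 := by
        by_contra hn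
        have hn' := lt_of_le_of_ne (not_lt.1 hn) (P.nz _ t2).symm
        rcases hC _ p1 _ rho _ t2 (by simp only [map_sub, map_add]; linarith) hn'
          (Or.inl (by abel)) with h | h
        · exact nrho h
        · have := P.nn _ h _ p2
          simp only [map_sub, LinearMap.sub_apply] at this
          linarith
      simp only [map_sub] at q1 q2
      linarith
  obtain ⟨r1, m1⟩ := main a1 a2 a3 a4 h11 h22 h33 h44 h12 h13 h14 h23 h24 h34 p1 p2 p3 p4 hgs
  obtain ⟨r2, m2⟩ := main a3 a4 a1 a2 h33 h44 h11 h22 h34 (by rw [H.symm]; exact h13)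
    (by rw [H.symm]; exact h23) (by rw [H.symm]; exact h14) (by rw [H.symm]; exact h24) h12
    p3 p4 p1 p2 (by rw [hgs]; abel)
  have fg : 2 * φ g = φ a1 + φ a2 + φ a3 + φ a4 := by
    have := congrArg φ hgs
    simpa using this
  rcases lt_or_gt_of_ne (P.nz _ r1) with h | h
  · apply m2
    simp only [map_sub, map_add] at h ⊢
    linarith
  · exact m1 h

end Exclusions

/-! ### The `F₄` configuration -/

section ExclusionF

variable {R : Set V} {B : V →ₗ[ℝ] V →ₗ[ℝ] ℝ} {φ : V →ₗ[ℝ] ℝ} {Ψ : Set V}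

lemma notF_aux (H : GoodForm R B) (P : PsiData R B φ Ψ) (w : ℝ → ℝ → ℝ → ℝ → V)
    (q0 q1 q2 q3 : ℝ)
    (ev : ∀ x0 x1 x2 x3 y0 y1 y2 y3, B (w x0 x1 x2 x3) (w y0 y1 y2 y3) =
      x0 * y0 + x1 * y1 + x2 * y2 + x3 * y3)
    (fv : ∀ x0 x1 x2 x3, φ (w x0 x1 x2 x3) = x0 * q0 + x1 * q1 + x2 * q2 + x3 * q3)
    (ws : ∀ x0 x1 x2 x3 y0 y1 y2 y3, w x0 x1 x2 x3 - w y0 y1 y2 y3 =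
      w (x0 - y0) (x1 - y1) (x2 - y2) (x3 - y3))
    (wa : ∀ x0 x1 x2 x3 y0 y1 y2 y3, w x0 x1 x2 x3 + w y0 y1 y2 y3 =
      w (x0 + y0) (x1 + y1) (x2 + y2) (x3 + y3))
    (wm : ∀ t x0 x1 x2 x3 : ℝ, t • w x0 x1 x2 x3 = w (t * x0) (t * x1) (t * x2) (t * x3))
    (p0 : w 2 0 0 0 ∈ Ψ) (p1 : w 0 1 1 0 ∈ Ψ) (p2 : w 0 1 0 1 ∈ Ψ) (p3 : w 0 0 1 1 ∈ Ψ)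
    (hg : w 1 1 1 1 ∈ R) (o1 : q2 < q1) (o2 : q3 < q2) : False := by
  have r0 := P.sub _ p0
  have r1 := P.sub _ p1
  have r2 := P.sub _ p2
  have r3 := P.sub _ p3
  have f0 := P.pos _ p0
  have f1 := P.pos _ p1
  have f2 := P.pos _ p2
  have f3 := P.pos _ p3
  rw [fv] at f0 f1 f2 f3
  have rs : ∀ {x0 x1 x2 x3 y0 y1 y2 y3 : ℝ} (z0 z1 z2 z3 : ℝ), w x0 x1 x2 x3 ∈ R →
      w y0 y1 y2 y3 ∈ R → x0 - y0 = z0 → x1 - y1 = z1 → x2 - y2 = z2 → x3 - y3 = z3 →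
      0 < x0 * y0 + x1 * y1 + x2 * y2 + x3 * y3 →
      2 * (x0 * y0 + x1 * y1 + x2 * y2 + x3 * y3) <
        (x0 * x0 + x1 * x1 + x2 * x2 + x3 * x3) + (y0 * y0 + y1 * y1 + y2 * y2 + y3 * y3) →
      w z0 z1 z2 z3 ∈ R := by
    intro x0 x1 x2 x3 y0 y1 y2 y3 z0 z1 z2 z3 hx hy e0 e1 e2 e3 h1 h2
    exact root_sub' H _ hx hy (by rw [ws, e0, e1, e2, e3]) (by rw [ev]; exact h1)
      (by rw [ev, ev, ev]; exact h2)
  have hf3 : w 1 0 0 1 ∈ R := by apply rs _ _ _ _ hg r1 <;> norm_num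
  have hf2 : w 1 0 1 0 ∈ R := by apply rs _ _ _ _ hg r2 <;> norm_num
  have hf1 : w 1 1 0 0 ∈ R := by apply rs _ _ _ _ hg r3 <;> norm_num
  have hm1 : w 1 (-1) 0 0 ∈ R := by apply rs _ _ _ _ hf3 r2 <;> norm_num
  have hm3 : w 1 0 0 (-1) ∈ R := by apply rs _ _ _ _ hf2 r3 <;> norm_num
  have d12 : w 0 1 (-1) 0 ∈ R := by apply rs _ _ _ _ r2 r3 <;> norm_num
  have d23 : w 0 0 1 (-1) ∈ R := by apply rs _ _ _ _ r1 r2 <;> norm_num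
  have hng : ∀ {x0 x1 x2 x3 : ℝ} (z0 z1 z2 z3 : ℝ), w x0 x1 x2 x3 ∈ R →
      -x0 = z0 → -x1 = z1 → -x2 = z2 → -x3 = z3 → w z0 z1 z2 z3 ∈ R := by
    intro x0 x1 x2 x3 z0 z1 z2 z3 hx e0 e1 e2 e3
    have := H.neg _ hx
    rw [← zero_sub, ← sub_self (w 0 0 0 0), ws, ws] at this
    simpa [e0, e1, e2, e3] using this
  have rf : ∀ {x0 x1 x2 x3 y0 y1 y2 y3 : ℝ} (z0 z1 z2 z3 : ℝ), w x0 x1 x2 x3 ∈ R →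
      w y0 y1 y2 y3 ∈ R → y0 * y0 + y1 * y1 + y2 * y2 + y3 * y3 = 2 →
      x0 * y0 + x1 * y1 + x2 * y2 + x3 * y3 = 2 →
      x0 - 2 * y0 = z0 → x1 - 2 * y1 = z1 → x2 - 2 * y2 = z2 → x3 - 2 * y3 = z3 →
      w z0 z1 z2 z3 ∈ R := by
    intro x0 x1 x2 x3 y0 y1 y2 y3 z0 z1 z2 z3 hx hy h1 h2 e0 e1 e2 e3
    have := H.refl_s _ hx _ hy (by rw [ev]; exact h1)
    rw [ev, h2, wm, ws, e0, e1, e2, e3] at this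
    exact this
  have mu1 : w 1 1 (-1) (-1) ∈ R := by apply rf _ _ _ _ hg r3 <;> norm_num
  have mu2 : w 1 (-1) 1 (-1) ∈ R := by apply rf _ _ _ _ hg r2 <;> norm_num
  have mu3 : w 1 (-1) (-1) 1 ∈ R := by apply rf _ _ _ _ hg r1 <;> norm_num
  have nu1 : w 1 (-1) 1 1 ∈ R := by apply rs _ _ _ _ r0 mu1 <;> norm_num
  have nu2 : w 1 1 (-1) 1 ∈ R := by apply rs _ _ _ _ r0 mu2 <;> norm_num
  have nu3 : w 1 1 1 (-1) ∈ R := by apply rs _ _ _ _ r0 mu3 <;> norm_num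
  have eta : w 1 (-1) (-1) (-1) ∈ R := by apply rs _ _ _ _ r0 hg <;> norm_num
  have eta' : w (-1) 1 1 1 ∈ R := by apply hng _ _ _ _ eta <;> norm_num
  have F1 : w 0 2 0 0 ∈ R := by apply rs _ _ _ _ hg nu1 <;> norm_num
  have F2 : w 0 0 2 0 ∈ R := by apply rs _ _ _ _ hg nu2 <;> norm_num
  have F3 : w 0 0 0 2 ∈ R := by apply rs _ _ _ _ hg nu3 <;> norm_num
  have nn : ∀ {x0 x1 x2 x3 y0 y1 y2 y3 : ℝ}, w x0 x1 x2 x3 ∈ Ψ → w y0 y1 y2 y3 ∈ Ψ →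
      x0 * y0 + x1 * y1 + x2 * y2 + x3 * y3 < 0 → False := by
    intro x0 x1 x2 x3 y0 y1 y2 y3 hx hy h
    have := P.nn _ hx _ hy
    rw [ev] at this
    linarith
  have nz1 := P.nz _ hm1
  have nz3 := P.nz _ hm3
  have nze := P.nz _ eta
  rw [fv] at nz1 nz3 nze
  have c1 : q0 < q1 ∨ q1 < q0 := lt_or_gt_of_ne (fun h => nz1 (by rw [h]; ring))
  rcases P.cl with hI | hC
  · have I : ∀ {x0 x1 x2 x3 y0 y1 y2 y3 : ℝ} (z0 z1 z2 z3 : ℝ), w x0 x1 x2 x3 ∈ Ψ →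
        w y0 y1 y2 y3 ∈ R → w z0 z1 z2 z3 ∈ R →
        x0 + y0 = z0 → x1 + y1 = z1 → x2 + y2 = z2 → x3 + y3 = z3 →
        0 < y0 * q0 + y1 * q1 + y2 * q2 + y3 * q3 → w z0 z1 z2 z3 ∈ Ψ := by
      intro x0 x1 x2 x3 y0 y1 y2 y3 z0 z1 z2 z3 hx hy hz e0 e1 e2 e3 h
      have e : w x0 x1 x2 x3 + w y0 y1 y2 y3 = w z0 z1 z2 z3 := by rw [wa, e0, e1, e2, e3]
      have := hI _ hx _ hy (by rw [fv]; exact h) (by rw [e]; exact hz)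
      rwa [e] at this
    rcases c1 with c1 | c1
    · have hm1' : w (-1) 1 0 0 ∈ R := by apply hng _ _ _ _ hm1 <;> norm_num
      have : w (-1) 1 1 1 ∈ Ψ := by
        apply I _ _ _ _ p3 hm1' eta' <;> first | norm_num | skip
        linarith
      exact nn this p0 (by norm_num)
    · have a1 : w 1 0 0 1 ∈ Ψ := by
        apply I _ _ _ _ p2 hm1 hf3 <;> first | norm_num | skip
        linarith
      have a2 : w 1 1 (-1) 1 ∈ Ψ := by
        apply I _ _ _ _ a1 d12 nu2 <;> first | norm_num | skip
        linarith
      have a3 : w 0 0 2 0 ∈ Ψ := by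
        apply I _ _ _ _ p3 d23 F2 <;> first | norm_num | skip
        linarith
      exact nn a2 a3 (by norm_num)
  · have C : ∀ {x0 x1 x2 x3 y0 y1 y2 y3 z0 z1 z2 z3 : ℝ}, w x0 x1 x2 x3 ∈ Ψ →
        w y0 y1 y2 y3 ∈ R → w z0 z1 z2 z3 ∈ R →
        (x0 = y0 + z0 ∧ x1 = y1 + z1 ∧ x2 = y2 + z2 ∧ x3 = y3 + z3 ∨
         2 * x0 = y0 + z0 ∧ 2 * x1 = y1 + z1 ∧ 2 * x2 = y2 + z2 ∧ 2 * x3 = y3 + z3) →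
        0 < y0 * q0 + y1 * q1 + y2 * q2 + y3 * q3 →
        0 < z0 * q0 + z1 * q1 + z2 * q2 + z3 * q3 →
        w y0 y1 y2 y3 ∈ Ψ ∨ w z0 z1 z2 z3 ∈ Ψ := by
      intro x0 x1 x2 x3 y0 y1 y2 y3 z0 z1 z2 z3 hx hy hz e h1 h2
      refine hC _ hx _ hy _ hz (by rw [fv]; exact h1) (by rw [fv]; exact h2) ?_
      rcases e with ⟨e0, e1, e2, e3⟩ | ⟨e0, e1, e2, e3⟩
      · left; rw [wa, e0, e1, e2, e3]
      · right; rw [wa, wm, e0, e1, e2, e3]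
    rcases c1 with c1 | c1
    · by_cases c3 : 0 < q0 - q3
      · rcases C p1 eta' hm3 (Or.inl (by norm_num)) (by linarith) (by linarith) with h | h
        · exact nn h p0 (by norm_num)
        · exact nn h p2 (by norm_num)
      · have c3' : q0 < q3 := by
          rcases lt_trichotomy q0 q3 with h | h | h
          · exact h
          · exact absurd (by rw [h]; ring) nz3
          · exact absurd (by linarith) c3
        have a3 : w 0 0 0 2 ∈ Ψ := by
          rcases C p3 d23 F3 (Or.inl (by norm_num)) (by linarith) (by linarith) with h | h
          · exact (nn h p2 (by norm_num)).elim
          · exact h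
        have hm3' : w (-1) 0 0 1 ∈ R := by apply hng _ _ _ _ hm3 <;> norm_num
        rcases C p1 nu3 hm3' (Or.inl (by norm_num)) (by linarith) (by linarith) with h | h
        · exact nn h a3 (by norm_num)
        · exact nn h p0 (by norm_num)
    · by_cases ce : 0 < -q0 + q1 + q2 + q3
      · rcases C p3 eta' hm1 (Or.inl (by norm_num)) (by linarith) (by linarith) with h | h
        · exact nn h p0 (by norm_num)
        · exact nn h p1 (by norm_num)
      · have ce' : 0 < q0 - q1 - q2 - q3 := by
          rcases lt_trichotomy 0 (q0 - q1 - q2 - q3) with h | h | h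
          · exact h
          · exact absurd (by linarith) nze
          · exact absurd (by linarith) ce
        have a1 : w 1 (-1) 1 1 ∈ Ψ := by
          rcases C p0 mu1 nu1 (Or.inl (by norm_num)) (by linarith) (by linarith) with h | h
          · exact (nn h p3 (by norm_num)).elim
          · exact h
        have a2 : w 1 1 (-1) 1 ∈ Ψ := by
          rcases C p0 mu2 nu2 (Or.inl (by norm_num)) (by linarith) (by linarith) with h | h
          · exact (nn h p2 (by norm_num)).elim
          · exact h
        rcases C p1 F1 F2 (Or.inr (by norm_num)) (by linarith) (by linarith) with h | h
        · exact nn h a1 (by norm_num)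
        · exact nn h a2 (by norm_num)

lemma notF_aux2 (H : GoodForm R B) (P : PsiData R B φ Ψ) (h f1 f2 f3 : V)
    (b00 : B h h = 1) (b11 : B f1 f1 = 1) (b22 : B f2 f2 = 1) (b33 : B f3 f3 = 1)
    (b01 : B h f1 = 0) (b02 : B h f2 = 0) (b03 : B h f3 = 0)
    (b12 : B f1 f2 = 0) (b13 : B f1 f3 = 0) (b23 : B f2 f3 = 0)
    (p0 : (2 : ℝ) • h ∈ Ψ) (p1 : f1 + f2 ∈ Ψ) (p2 : f1 + f3 ∈ Ψ) (p3 : f2 + f3 ∈ Ψ)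
    (hg : h + f1 + f2 + f3 ∈ R) (o1 : φ f2 < φ f1) (o2 : φ f3 < φ f2) : False := by
  have b10 : B f1 h = 0 := by rw [H.symm]; exact b01
  have b20 : B f2 h = 0 := by rw [H.symm]; exact b02
  have b30 : B f3 h = 0 := by rw [H.symm]; exact b03
  have b21 : B f2 f1 = 0 := by rw [H.symm]; exact b12
  have b31 : B f3 f1 = 0 := by rw [H.symm]; exact b13
  have b32 : B f3 f2 = 0 := by rw [H.symm]; exact b23
  refine notF_aux H P (fun x0 x1 x2 x3 => x0 • h + x1 • f1 + x2 • f2 + x3 • f3)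
    (φ h) (φ f1) (φ f2) (φ f3) ?_ ?_ ?_ ?_ ?_ ?_ ?_ ?_ ?_ ?_ o1 o2
  · intros
    simp only [map_add, map_smul, LinearMap.add_apply, LinearMap.smul_apply, smul_eq_mul,
      b00, b01, b02, b03, b10, b11, b12, b13, b20, b21, b22, b23, b30, b31, b32, b33]
    ring
  · intros
    simp only [map_add, map_smul, smul_eq_mul]
  · intros
    module
  · intros
    module
  · intros
    module
  all_goals simpa

lemma notF (H : GoodForm R B) (P : PsiData R B φ Ψ) (l s1 s2 s3 g : V)
    (hll : B l l = 4) (h11 : B s1 s1 = 2) (h22 : B s2 s2 = 2) (h33 : B s3 s3 = 2)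
    (hl1 : B l s1 = 0) (hl2 : B l s2 = 0) (hl3 : B l s3 = 0)
    (h12 : B s1 s2 = 1) (h13 : B s1 s3 = 1) (h23 : B s2 s3 = 1)
    (p0 : l ∈ Ψ) (p1 : s1 ∈ Ψ) (p2 : s2 ∈ Ψ) (p3 : s3 ∈ Ψ) (hg : g ∈ R)
    (hgs : (2 : ℝ) • g = l + s1 + s2 + s3) : False := by
  have h21 : B s2 s1 = 1 := by rw [H.symm]; exact h12
  have h31 : B s3 s1 = 1 := by rw [H.symm]; exact h13
  have h32 : B s3 s2 = 1 := by rw [H.symm]; exact h23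
  obtain ⟨h, hh⟩ : ∃ h, h = (1 / 2 : ℝ) • l := ⟨_, rfl⟩
  obtain ⟨f1, hf1⟩ : ∃ f, f = (1 / 2 : ℝ) • (s1 + s2 - s3) := ⟨_, rfl⟩
  obtain ⟨f2, hf2⟩ : ∃ f, f = (1 / 2 : ℝ) • (s1 + s3 - s2) := ⟨_, rfl⟩
  obtain ⟨f3, hf3⟩ : ∃ f, f = (1 / 2 : ℝ) • (s2 + s3 - s1) := ⟨_, rfl⟩
  have b00 : B h h = 1 := by
    simp only [hh, map_smul, LinearMap.smul_apply, smul_eq_mul, hll]; norm_num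
  have comp : ∀ x y z x' y' z' : ℝ, B (x • s1 + y • s2 + z • s3) (x' • s1 + y' • s2 + z' • s3)
      = 2 * (x * x' + y * y' + z * z') + x * y' + x * z' + y * x' + y * z' + z * x' + z * y' := by
    intros
    simp only [map_add, map_smul, LinearMap.add_apply, LinearMap.smul_apply, smul_eq_mul,
      h11, h22, h33, h12, h13, h23, h21, h31, h32]
    ring
  have e1 : f1 = (1 / 2 : ℝ) • s1 + (1 / 2 : ℝ) • s2 + (-1 / 2 : ℝ) • s3 := by rw [hf1]; module
  have e2 : f2 = (1 / 2 : ℝ) • s1 + (-1 / 2 : ℝ) • s2 + (1 / 2 : ℝ) • s3 := by rw [hf2]; module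
  have e3 : f3 = (-1 / 2 : ℝ) • s1 + (1 / 2 : ℝ) • s2 + (1 / 2 : ℝ) • s3 := by rw [hf3]; module
  have b11 : B f1 f1 = 1 := by rw [e1, comp]; norm_num
  have b22 : B f2 f2 = 1 := by rw [e2, comp]; norm_num
  have b33 : B f3 f3 = 1 := by rw [e3, comp]; norm_num
  have b12 : B f1 f2 = 0 := by rw [e1, e2, comp]; norm_num
  have b13 : B f1 f3 = 0 := by rw [e1, e3, comp]; norm_num
  have b23 : B f2 f3 = 0 := by rw [e2, e3, comp]; norm_num
  have b01 : B h f1 = 0 := by simp [hh, e1, hl1, hl2, hl3]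
  have b02 : B h f2 = 0 := by simp [hh, e2, hl1, hl2, hl3]
  have b03 : B h f3 = 0 := by simp [hh, e3, hl1, hl2, hl3]
  have b21 : B f2 f1 = 0 := by rw [H.symm]; exact b12
  have b31 : B f3 f1 = 0 := by rw [H.symm]; exact b13
  have b32 : B f3 f2 = 0 := by rw [H.symm]; exact b23
  have q0 : (2 : ℝ) • h ∈ Ψ := by convert p0 using 1; rw [hh]; module
  have q1 : f1 + f2 ∈ Ψ := by convert p1 using 1; rw [hf1, hf2]; module
  have q2 : f1 + f3 ∈ Ψ := by convert p2 using 1; rw [hf1, hf3]; module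
  have q3 : f2 + f3 ∈ Ψ := by convert p3 using 1; rw [hf2, hf3]; module
  have q1' : f2 + f1 ∈ Ψ := by rwa [add_comm]
  have q2' : f3 + f1 ∈ Ψ := by rwa [add_comm]
  have q3' : f3 + f2 ∈ Ψ := by rwa [add_comm]
  have hg' : h + f1 + f2 + f3 ∈ R := by
    have : g = (1 / 2 : ℝ) • ((2 : ℝ) • g) := by module
    rw [this, hgs] at hg
    convert hg using 1
    rw [hh, hf1, hf2, hf3]; module
  have d12 : f1 - f2 ∈ R := root_sub' H _ (P.sub _ q2) (P.sub _ q3) (by abel)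
    (by simp only [map_add, LinearMap.add_apply, b12, b13, b23, b32, b33]; norm_num)
    (by simp only [map_add, LinearMap.add_apply, b11, b22, b12, b13, b31, b23, b32, b33]; norm_num)
  have d13 : f1 - f3 ∈ R := root_sub' H _ (P.sub _ q1) (P.sub _ q3) (by abel)
    (by simp only [map_add, LinearMap.add_apply, b12, b13, b23, b22, b33]; norm_num)
    (by simp only [map_add, LinearMap.add_apply, b11, b22, b12, b21, b13, b31, b23, b32, b33]
        norm_num)
  have d23 : f2 - f3 ∈ R := root_sub' H _ (P.sub _ q1) (P.sub _ q2) (by abel)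
    (by simp only [map_add, LinearMap.add_apply, b11, b21, b13, b23, b22, b33]; norm_num)
    (by simp only [map_add, LinearMap.add_apply, b11, b22, b12, b21, b13, b31, b23, b32, b33]
        norm_num)
  have n12 := P.nz _ d12
  have n13 := P.nz _ d13
  have n23 := P.nz _ d23
  rw [map_sub, sub_ne_zero] at n12 n13 n23
  have A := fun x y z hx hy hz => notF_aux2 H P h x y z b00 hx hy hz
  rcases lt_or_gt_of_ne n12 with o12 | o12 <;> rcases lt_or_gt_of_ne n13 with o13 | o13 <;>
    rcases lt_or_gt_of_ne n23 with o23 | o23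
  · exact A f3 f2 f1 b33 b22 b11 b03 b02 b01 b32 b31 b21 q0 q3' q2' q1'
      (by convert hg' using 1; abel) o23 o12
  · exact A f2 f3 f1 b22 b33 b11 b02 b03 b01 b23 b21 b31 q0 q3 q1' q2'
      (by convert hg' using 1; abel) o23 o13
  · linarith
  · exact A f2 f1 f3 b22 b11 b33 b02 b01 b03 b21 b23 b13 q0 q1' q3 q2
      (by convert hg' using 1; abel) o12 o13
  · exact A f3 f1 f2 b33 b11 b22 b03 b01 b02 b31 b32 b12 q0 q2' q3' q1
      (by convert hg' using 1; abel) o13 o12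
  · linarith
  · exact A f1 f3 f2 b11 b33 b22 b01 b03 b02 b13 b12 b32 q0 q2 q1 q3'
      (by convert hg' using 1; abel) o13 o23
  · exact A f1 f2 f3 b11 b22 b33 b01 b02 b03 b12 b13 b23 q0 q1 q2 q3 hg' o12 o23

end ExclusionF

/-! ### Four roots of `Ψ` whose sum is a sum of two roots -/

section Config

variable {R : Set V} {B : V →ₗ[ℝ] V →ₗ[ℝ] ℝ} {φ : V →ₗ[ℝ] ℝ} {Ψ : Set V}

lemma bz_pair (H : GoodForm R B) {a b : V} (ha : a ∈ R) (hb : b ∈ R) :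
    -(bz B a a + bz B b b) ≤ 2 * bz B a b ∧ 2 * bz B a b ≤ bz B a a + bz B b b ∧
    (bz B a a = 4 → bz B a b % 2 = 0) ∧ (bz B b b = 4 → bz B a b % 2 = 0) := by
  refine ⟨(bz_bound H ha hb).1, (bz_bound H ha hb).2, fun h => ?_, fun h => ?_⟩
  · obtain ⟨n, hn⟩ := bz_even H ha hb h; omega
  · obtain ⟨n, hn⟩ := bz_even H hb ha h; rw [bz_symm H] at hn; omega

lemma bz_len' (H : GoodForm R B) {a : V} (ha : a ∈ R) {n : ℤ} (h : bz B a a = n) : B a a = n := by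
  rw [← bz_cast H ha ha, h]

lemma bz_val (H : GoodForm R B) {a b : V} (ha : a ∈ R) (hb : b ∈ R) {n : ℤ} (h : bz B a b = n) :
    B a b = n := by
  rw [← bz_cast H ha hb, h]

/-- Four roots of `Ψ` whose sum is `g + d` with `g`, `d` roots. -/
structure Cfg (R : Set V) (B : V →ₗ[ℝ] V →ₗ[ℝ] ℝ) (Ψ : Set V) (a1 a2 a3 a4 g d : V) : Prop where
  m1 : a1 ∈ Ψ
  m2 : a2 ∈ Ψ
  m3 : a3 ∈ Ψ
  m4 : a4 ∈ Ψ
  mg : g ∈ R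
  md : d ∈ R
  sum : g + d = a1 + a2 + a3 + a4

lemma Cfg.ints (H : GoodForm R B) (P : PsiData R B φ Ψ) {a1 a2 a3 a4 g d : V}
    (C : Cfg R B Ψ a1 a2 a3 a4 g d) :
    ((bz B a1 a1 = 2 ∨ bz B a1 a1 = 4) ∧ (bz B a2 a2 = 2 ∨ bz B a2 a2 = 4) ∧
     (bz B a3 a3 = 2 ∨ bz B a3 a3 = 4) ∧ (bz B a4 a4 = 2 ∨ bz B a4 a4 = 4) ∧
     (bz B g g = 2 ∨ bz B g g = 4) ∧ (bz B d d = 2 ∨ bz B d d = 4)) ∧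
    (0 ≤ bz B a1 a2 ∧ 0 ≤ bz B a1 a3 ∧ 0 ≤ bz B a1 a4 ∧ 0 ≤ bz B a2 a3 ∧ 0 ≤ bz B a2 a4 ∧
      0 ≤ bz B a3 a4) ∧
    (bz B g a1 + bz B d a1 = bz B a1 a1 + bz B a1 a2 + bz B a1 a3 + bz B a1 a4 ∧
     bz B g a2 + bz B d a2 = bz B a1 a2 + bz B a2 a2 + bz B a2 a3 + bz B a2 a4 ∧
     bz B g a3 + bz B d a3 = bz B a1 a3 + bz B a2 a3 + bz B a3 a3 + bz B a3 a4 ∧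
     bz B g a4 + bz B d a4 = bz B a1 a4 + bz B a2 a4 + bz B a3 a4 + bz B a4 a4 ∧
     bz B g g + bz B g d = bz B g a1 + bz B g a2 + bz B g a3 + bz B g a4 ∧
     bz B d d + bz B g d = bz B d a1 + bz B d a2 + bz B d a3 + bz B d a4) := by
  obtain ⟨m1, m2, m3, m4, mg, md, hs⟩ := C
  have r1 := P.sub _ m1
  have r2 := P.sub _ m2
  have r3 := P.sub _ m3
  have r4 := P.sub _ m4
  have nn : ∀ a ∈ Ψ, ∀ b ∈ Ψ, 0 ≤ bz B a b := by
    intro a ha b hb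
    have h := P.nn _ ha _ hb
    rw [← bz_cast H (P.sub _ ha) (P.sub _ hb)] at h
    exact_mod_cast h
  have row : ∀ x ∈ R, bz B g x + bz B d x = bz B a1 x + bz B a2 x + bz B a3 x + bz B a4 x := by
    intro x hx
    have h := congrArg (fun v => B v x) hs
    simp only [map_add, LinearMap.add_apply] at h
    rw [← bz_cast H mg hx, ← bz_cast H md hx, ← bz_cast H r1 hx, ← bz_cast H r2 hx,
      ← bz_cast H r3 hx, ← bz_cast H r4 hx] at h
    exact_mod_cast h
  refine ⟨⟨bz_len H r1, bz_len H r2, bz_len H r3, bz_len H r4, bz_len H mg, bz_len H md⟩,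
    ⟨nn _ m1 _ m2, nn _ m1 _ m3, nn _ m1 _ m4, nn _ m2 _ m3, nn _ m2 _ m4, nn _ m3 _ m4⟩,
    ?_, ?_, ?_, ?_, ?_, ?_⟩
  · rw [row _ r1, bz_symm H a2 a1, bz_symm H a3 a1, bz_symm H a4 a1]
  · rw [row _ r2, bz_symm H a3 a2, bz_symm H a4 a2]
  · rw [row _ r3, bz_symm H a4 a3]
  · rw [row _ r4]
  · rw [bz_symm H g d, row _ mg, bz_symm H a1, bz_symm H a2, bz_symm H a3, bz_symm H a4]
  · rw [add_comm, row _ md, bz_symm H a1, bz_symm H a2, bz_symm H a3, bz_symm H a4]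

lemma Cfg.pairs (H : GoodForm R B) (P : PsiData R B φ Ψ) {a1 a2 a3 a4 g d : V}
    (C : Cfg R B Ψ a1 a2 a3 a4 g d) :
    ∀ x ∈ ({a1, a2, a3, a4, g, d} : Set V), ∀ y ∈ ({a1, a2, a3, a4, g, d} : Set V),
    -(bz B x x + bz B y y) ≤ 2 * bz B x y ∧ 2 * bz B x y ≤ bz B x x + bz B y y ∧
    (bz B x x = 4 → bz B x y % 2 = 0) ∧ (bz B y y = 4 → bz B x y % 2 = 0) := by
  have m : ∀ x ∈ ({a1, a2, a3, a4, g, d} : Set V), x ∈ R := by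
    intro x hx
    simp only [Set.mem_insert_iff, Set.mem_singleton_iff] at hx
    rcases hx with rfl | rfl | rfl | rfl | rfl | rfl
    exacts [P.sub _ C.m1, P.sub _ C.m2, P.sub _ C.m3, P.sub _ C.m4, C.mg, C.md]
  intro x hx y hy
  exact bz_pair H (m x hx) (m y hy)

lemma short_pair (H : GoodForm R B) {g s t : V} (hg : g ∈ R) (hs : s ∈ R) (ht : t ∈ R)
    (hgg : bz B g g = 4) (hss : bz B s s = 2) (htt : bz B t t = 2) (hst : bz B s t = 0)
    (hgs : bz B g s = 2) (hgt : bz B g t = 2) : g = s + t := by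
  have e1 := bz_val H hg hg hgg
  have e2 := bz_val H hs hs hss
  have e3 := bz_val H ht ht htt
  have e4 := bz_val H hs ht hst
  have e5 := bz_val H hg hs hgs
  have e6 := bz_val H hg ht hgt
  have : g - (s + t) = 0 := H.definite _ (by
    simp only [map_sub, map_add, LinearMap.sub_apply, LinearMap.add_apply, H.symm s g, H.symm t g,
      H.symm t s, e1, e2, e3, e4, e5, e6]
    norm_num)
  exact sub_eq_zero.1 this

lemma Cfg.swap12 {a1 a2 a3 a4 g d : V} (C : Cfg R B Ψ a1 a2 a3 a4 g d) :
    Cfg R B Ψ a2 a1 a3 a4 g d :=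
  ⟨C.m2, C.m1, C.m3, C.m4, C.mg, C.md, by rw [C.sum]; abel⟩

lemma Cfg.swap23 {a1 a2 a3 a4 g d : V} (C : Cfg R B Ψ a1 a2 a3 a4 g d) :
    Cfg R B Ψ a1 a3 a2 a4 g d :=
  ⟨C.m1, C.m3, C.m2, C.m4, C.mg, C.md, by rw [C.sum]; abel⟩

lemma Cfg.swap34 {a1 a2 a3 a4 g d : V} (C : Cfg R B Ψ a1 a2 a3 a4 g d) :
    Cfg R B Ψ a1 a2 a4 a3 g d :=
  ⟨C.m1, C.m2, C.m4, C.m3, C.mg, C.md, by rw [C.sum]; abel⟩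

lemma Cfg.swapg {a1 a2 a3 a4 g d : V} (C : Cfg R B Ψ a1 a2 a3 a4 g d) :
    Cfg R B Ψ a1 a2 a3 a4 d g :=
  ⟨C.m1, C.m2, C.m3, C.m4, C.md, C.mg, by rw [add_comm, C.sum]⟩

lemma two_smul_of {g d v : V} (h : g + d = v) (e : g = d) : (2 : ℝ) • g = v := by
  rw [← h, ← e]; module

lemma not_k4 (H : GoodForm R B) (P : PsiData R B φ Ψ) {a1 a2 a3 a4 g d : V}
    (C : Cfg R B Ψ a1 a2 a3 a4 g d) (n1 : bz B a1 a1 = 4) (n2 : bz B a2 a2 = 4)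
    (n3 : bz B a3 a3 = 4) (n4 : bz B a4 a4 = 4) : False := by
  obtain ⟨⟨-, -, -, -, lg, ld⟩, ⟨q12, q13, q14, q23, q24, q34⟩, s1, s2, s3, s4, sg, sd⟩ := C.ints H P
  have pr := C.pairs H P
  have pe := pr g (by simp) d (by simp)
  have z : bz B a1 a2 = 0 ∧ bz B a1 a3 = 0 ∧ bz B a1 a4 = 0 ∧ bz B a2 a3 = 0 ∧ bz B a2 a4 = 0 ∧
    bz B a3 a4 = 0 ∧ 2 * bz B g d = bz B g g + bz B d d := by
    clear pr; omega
  obtain ⟨z1, z2, z3, z4, z5, z6, z7⟩ := z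
  have r1 := P.sub _ C.m1
  have r2 := P.sub _ C.m2
  have r3 := P.sub _ C.m3
  have r4 := P.sub _ C.m4
  exact notD4 H P 4 (by norm_num) a1 a2 a3 a4 g
    (by simpa using bz_val H r1 r1 n1) (by simpa using bz_val H r2 r2 n2)
    (by simpa using bz_val H r3 r3 n3) (by simpa using bz_val H r4 r4 n4)
    (by simpa using bz_val H r1 r2 z1) (by simpa using bz_val H r1 r3 z2)
    (by simpa using bz_val H r1 r4 z3) (by simpa using bz_val H r2 r3 z4)
    (by simpa using bz_val H r2 r4 z5) (by simpa using bz_val H r3 r4 z6)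
    C.m1 C.m2 C.m3 C.m4 C.mg (two_smul_of C.sum (bz_eq H C.mg C.md z7))

lemma not_k3 (H : GoodForm R B) (P : PsiData R B φ Ψ) {a1 a2 a3 a4 g d : V}
    (C : Cfg R B Ψ a1 a2 a3 a4 g d) (n1 : bz B a1 a1 = 4) (n2 : bz B a2 a2 = 4)
    (n3 : bz B a3 a3 = 4) (n4 : bz B a4 a4 = 2) : False := by
  obtain ⟨⟨-, -, -, -, lg, ld⟩, ⟨q12, q13, q14, q23, q24, q34⟩, s1, s2, s3, s4, sg, sd⟩ := C.ints H P
  have pr := C.pairs H P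
  have pe := pr g (by simp) d (by simp)
  have p12 := (pr a1 (by simp) a2 (by simp)).2.2.1 n1
  have p13 := (pr a1 (by simp) a3 (by simp)).2.2.1 n1
  have p14 := (pr a1 (by simp) a4 (by simp)).2.2.1 n1
  have p23 := (pr a2 (by simp) a3 (by simp)).2.2.1 n2
  have p24 := (pr a2 (by simp) a4 (by simp)).2.2.1 n2
  have p34 := (pr a3 (by simp) a4 (by simp)).2.2.1 n3
  clear pr
  omega

set_option maxHeartbeats 2000000 in
lemma not_k2 (H : GoodForm R B) (P : PsiData R B φ Ψ) {a1 a2 a3 a4 g d : V}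
    (C : Cfg R B Ψ a1 a2 a3 a4 g d) (n1 : bz B a1 a1 = 4) (n2 : bz B a2 a2 = 4)
    (n3 : bz B a3 a3 = 2) (n4 : bz B a4 a4 = 2) : False := by
  obtain ⟨⟨-, -, -, -, lg, ld⟩, ⟨q12, q13, q14, q23, q24, q34⟩, s1, s2, s3, s4, sg, sd⟩ := C.ints H P
  have r1 := P.sub _ C.m1
  have r2 := P.sub _ C.m2
  have r3 := P.sub _ C.m3
  have r4 := P.sub _ C.m4
  have pr := C.pairs H P
  obtain ⟨pe1, pe2, pe3, pe4⟩ := pr g (by simp) d (by simp)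
  have p12 := (pr a1 (by simp) a2 (by simp)).2.2.1 n1
  have p13 := (pr a1 (by simp) a3 (by simp)).2.2.1 n1
  have p14 := (pr a1 (by simp) a4 (by simp)).2.2.1 n1
  have p23 := (pr a2 (by simp) a3 (by simp)).2.2.1 n2
  have p24 := (pr a2 (by simp) a4 (by simp)).2.2.1 n2
  have p34 := pr a3 (by simp) a4 (by simp)
  have G1 := pr g (by simp) a1 (by simp)
  have G2 := pr g (by simp) a2 (by simp)
  have G3 := pr g (by simp) a3 (by simp)
  have G4 := pr g (by simp) a4 (by simp)
  have D1 := pr d (by simp) a1 (by simp)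
  have D2 := pr d (by simp) a2 (by simp)
  have D3 := pr d (by simp) a3 (by simp)
  have D4 := pr d (by simp) a4 (by simp)
  clear pr
  have tot : 12 + 2 * (bz B a1 a2 + bz B a1 a3 + bz B a1 a4 + bz B a2 a3 + bz B a2 a4 + bz B a3 a4)
      = bz B g g + bz B d d + 2 * bz B g d := by linarith
  have lgd : bz B g g = 4 ∧ bz B d d = 4 := by
    clear G1 G2 G3 G4 D1 D2 D3 D4 s1 s2 s3 s4 sg sd p34 p12 p13 p14 p23 p24
    rcases lg with lg | lg <;> rcases ld with ld | ld
    · omega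
    · have := pe4 ld; clear pe3 pe4; omega
    · have := pe3 lg; clear pe3 pe4; omega
    · exact ⟨lg, ld⟩
  obtain ⟨lg, ld⟩ := lgd
  have ev := pe3 lg
  clear pe3 pe4
  have e24 : bz B g d = 2 ∨ bz B g d = 4 := by
    clear G1 G2 G3 G4 D1 D2 D3 D4 s1 s2 s3 s4 sg sd; omega
  have c1 := (C.m1)
  have A : ∀ s, s ∈ Ψ → bz B s s = 2 → bz B a1 s = 0 → bz B a2 s = 0 → bz B a1 a2 = 0 →
      (2 : ℝ) • g = a1 + a2 + (2 : ℝ) • s → False := by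
    intro s hs h1 h2 h3 h4 h5
    have rs := P.sub _ hs
    exact notA H P a1 a2 s g (by simpa using bz_val H r1 r1 n1) (by simpa using bz_val H r2 r2 n2)
      (by simpa using bz_val H rs rs h1) (by simpa using bz_val H r1 r2 h4)
      (by simpa using bz_val H r1 rs h2) (by simpa using bz_val H r2 rs h3)
      C.m1 C.m2 hs C.mg h5
  rcases e24 with e | e
  · have z : bz B a1 a2 = 0 ∧ bz B a1 a3 = 0 ∧ bz B a1 a4 = 0 ∧ bz B a2 a3 = 0 ∧ bz B a2 a4 = 0 ∧
      bz B a3 a4 = 0 := by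
      clear G1 G2 G3 G4 D1 D2 D3 D4 s1 s2 s3 s4 sg sd
      refine ⟨?_, ?_, ?_, ?_, ?_, ?_⟩ <;> omega
    obtain ⟨z1, z2, z3, z4, z5, z6⟩ := z
    have key : ∀ a ∈ R, bz B a a = 4 → bz B g a + bz B d a = 4 → bz B g a = 2 := by
      intro a ra ha hs
      have h1 := bz_pair H C.mg ra
      have h2 := bz_pair H C.md ra
      have c1 : bz B g a ≠ 4 := by
        intro h
        have := bz_eq H C.mg ra (by omega)
        subst this
        rw [bz_symm H] at e
        omega
      have c2 : bz B d a ≠ 4 := by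
        intro h
        have := bz_eq H C.md ra (by omega)
        subst this
        omega
      omega
    have g1 := key a1 r1 n1 (by omega)
    have g2 := key a2 r2 n2 (by omega)
    have B2 : ∀ s, s ∈ Ψ → bz B s s = 2 → bz B a1 s = 0 → bz B a2 s = 0 → bz B g s = 2 → False := by
      intro s hs h1 h2 h3 h4
      refine A s hs h1 h2 h3 z1 ?_
      have rs := P.sub _ hs
      have e1 := bz_val H C.mg C.mg lg
      have e2 := bz_val H C.mg r1 g1
      have e3 := bz_val H C.mg r2 g2
      have e4 := bz_val H C.mg rs h4
      have e5 := bz_val H r1 r1 n1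
      have e6 := bz_val H r2 r2 n2
      have e7 := bz_val H rs rs h1
      have e8 := bz_val H r1 rs h2
      have e9 := bz_val H r2 rs h3
      have e10 := bz_val H r1 r2 z1
      have : (2 : ℝ) • g - (a1 + a2 + (2 : ℝ) • s) = 0 := H.definite _ (by
        simp only [map_sub, map_add, map_smul, LinearMap.sub_apply, LinearMap.add_apply,
          LinearMap.smul_apply, smul_eq_mul, H.symm a1 g, H.symm a2 g, H.symm s g, H.symm a2 a1,
          H.symm s a1, H.symm s a2, e1, e2, e3, e4, e5, e6, e7, e8, e9, e10]
        norm_num)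
      exact sub_eq_zero.1 this
    have G3' := G3.2.2.1 lg
    have G4' := G4.2.2.1 lg
    have : bz B g a3 = 2 ∨ bz B g a4 = 2 := by
      obtain ⟨-, G3, -, -⟩ := G3
      obtain ⟨-, G4, -, -⟩ := G4
      clear G1 G2 D1 D2 D3 D4
      omega
    rcases this with h | h
    · exact B2 a3 C.m3 n3 z2 z4 h
    · exact B2 a4 C.m4 n4 z3 z5 h
  · have egd := bz_eq H C.mg C.md (by omega)
    have sm := two_smul_of C.sum egd
    subst egd
    have z : bz B a1 a2 = 0 ∧ bz B a1 a3 = 0 ∧ bz B a1 a4 = 0 ∧ bz B a2 a3 = 0 ∧ bz B a2 a4 = 0 ∧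
      bz B a3 a4 = 2 := by
      have G1' := G1.2.2.1 lg
      have G2' := G2.2.2.1 lg
      have G3' := G3.2.2.1 lg
      have G4' := G4.2.2.1 lg
      obtain ⟨-, G3, -, -⟩ := G3
      obtain ⟨-, G4, -, -⟩ := G4
      have p34 := p34.2.1
      clear pe1 pe2 D1 D2 D3 D4 G1 G2
      have : bz B g a3 = 2 := by omega
      have : bz B g a4 = 2 := by omega
      refine ⟨?_, ?_, ?_, ?_, ?_, ?_⟩ <;> omega
    obtain ⟨z1, z2, z3, z4, z5, z6⟩ := z
    have := bz_eq H r3 r4 (by omega)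
    subst this
    exact A a3 C.m3 n3 z2 z4 z1 (by rw [sm]; module)

set_option maxHeartbeats 2000000 in
lemma not_k1_aux (H : GoodForm R B) (P : PsiData R B φ Ψ) {a1 a2 a3 a4 g d : V}
    (C : Cfg R B Ψ a1 a2 a3 a4 g d) (n1 : bz B a1 a1 = 4) (n2 : bz B a2 a2 = 2)
    (n3 : bz B a3 a3 = 2) (n4 : bz B a4 a4 = 2) (lg : bz B g g = 4) : False := by
  obtain ⟨⟨-, -, -, -, -, ld⟩, ⟨q12, q13, q14, q23, q24, q34⟩, s1, s2, s3, s4, sg, sd⟩ := C.ints H P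
  have r1 := P.sub _ C.m1
  have r2 := P.sub _ C.m2
  have r3 := P.sub _ C.m3
  have r4 := P.sub _ C.m4
  have pr := C.pairs H P
  obtain ⟨pe1, pe2, pe3, pe4⟩ := pr g (by simp) d (by simp)
  have ev := pe3 lg
  have p12 := (pr a1 (by simp) a2 (by simp)).2.2.1 n1
  have p13 := (pr a1 (by simp) a3 (by simp)).2.2.1 n1
  have p14 := (pr a1 (by simp) a4 (by simp)).2.2.1 n1
  have G1 := pr g (by simp) a1 (by simp)
  have G2 := pr g (by simp) a2 (by simp)
  have G3 := pr g (by simp) a3 (by simp)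
  have G4 := pr g (by simp) a4 (by simp)
  have D1 := pr d (by simp) a1 (by simp)
  have D2 := pr d (by simp) a2 (by simp)
  have D3 := pr d (by simp) a3 (by simp)
  have D4 := pr d (by simp) a4 (by simp)
  clear pr pe3 pe4
  have tot : 10 + 2 * (bz B a1 a2 + bz B a1 a3 + bz B a1 a4 + bz B a2 a3 + bz B a2 a4 + bz B a3 a4)
      = bz B g g + bz B d d + 2 * bz B g d := by linarith
  rcases ld with ld | ld
  · have z : bz B a1 a2 = 0 ∧ bz B a1 a3 = 0 ∧ bz B a1 a4 = 0 ∧ bz B a2 a3 = 0 ∧ bz B a2 a4 = 0 ∧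
      bz B a3 a4 = 0 ∧ bz B g d = 2 := by
      clear G1 G2 G3 G4 D1 D2 D3 D4 s1 s2 s3 s4 sg sd
      refine ⟨?_, ?_, ?_, ?_, ?_, ?_, ?_⟩ <;> omega
    obtain ⟨z1, z2, z3, z4, z5, z6, e⟩ := z
    have c1 : bz B g a1 ≠ 4 := by
      intro h
      have := bz_eq H C.mg r1 (by omega)
      subst this
      rw [bz_symm H] at e
      omega
    have G1' := G1.2.2.1 lg
    have G2' := G2.2.2.1 lg
    have G3' := G3.2.2.1 lg
    have G4' := G4.2.2.1 lg
    have D1' := D1.2.2.2 n1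
    obtain ⟨-, G1, -, -⟩ := G1
    obtain ⟨-, G2, -, -⟩ := G2
    obtain ⟨-, G3, -, -⟩ := G3
    obtain ⟨-, G4, -, -⟩ := G4
    obtain ⟨-, D1, -, -⟩ := D1
    clear D2 D3 D4
    have g1 : bz B g a1 = 2 := by clear s2 s3 s4 sg sd tot; omega
    have K : ∀ s t, s ∈ R → t ∈ R → bz B s s = 2 → bz B t t = 2 → bz B s t = 0 → bz B g s = 2 →
        bz B g t = 2 → bz B a1 s = 0 → bz B a1 t = 0 → False := by
      intro s t rs rt hs ht hst hgs hgt h1 h2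
      have := short_pair H C.mg rs rt lg hs ht hst hgs hgt
      have e1 := bz_val H C.mg r1 g1
      have e2 := bz_val H r1 rs h1
      have e3 := bz_val H r1 rt h2
      rw [this, map_add, LinearMap.add_apply, H.symm s, H.symm t, e2, e3] at e1
      norm_num at e1
    have : (bz B g a2 = 2 ∧ bz B g a3 = 2) ∨ (bz B g a2 = 2 ∧ bz B g a4 = 2) ∨
        (bz B g a3 = 2 ∧ bz B g a4 = 2) := by
      clear s1 s2 s3 s4 sd tot D1 D1' G1 G1'; omega
    rcases this with ⟨h, h'⟩ | ⟨h, h'⟩ | ⟨h, h'⟩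
    · exact K a2 a3 r2 r3 n2 n3 z4 h h' z1 z2
    · exact K a2 a4 r2 r4 n2 n4 z5 h h' z1 z3
    · exact K a3 a4 r3 r4 n3 n4 z6 h h' z2 z3
  · have G1' := G1.2.2.1 lg
    have G2' := G2.2.2.1 lg
    have G3' := G3.2.2.1 lg
    have G4' := G4.2.2.1 lg
    have D1' := D1.2.2.1 ld
    have D2' := D2.2.2.1 ld
    have D3' := D3.2.2.1 ld
    have D4' := D4.2.2.1 ld
    have e : bz B g d = 4 := by
      clear G1 G2 G3 G4 D1 D2 D3 D4
      have : bz B g d = 2 ∨ bz B g d = 4 := by omega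
      rcases this with h | h
      · exfalso
        have : bz B a1 a2 = 0 ∧ bz B a1 a3 = 0 ∧ bz B a1 a4 = 0 := by omega
        have : bz B a2 a3 + bz B a2 a4 + bz B a3 a4 = 1 := by omega
        omega
      · exact h
    have egd := bz_eq H C.mg C.md (by omega)
    have sm := two_smul_of C.sum egd
    subst egd
    clear D1 D2 D3 D4 D1' D2' D3' D4'
    have z : bz B a1 a2 = 0 ∧ bz B a1 a3 = 0 ∧ bz B a1 a4 = 0 ∧ bz B a2 a3 = 1 ∧ bz B a2 a4 = 1 ∧
      bz B a3 a4 = 1 := by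
      obtain ⟨-, G2, -, -⟩ := G2
      obtain ⟨-, G3, -, -⟩ := G3
      obtain ⟨-, G4, -, -⟩ := G4
      clear G1 pe1 pe2 ev
      have : bz B g a2 = 2 := by omega
      have : bz B g a3 = 2 := by omega
      have : bz B g a4 = 2 := by omega
      refine ⟨?_, ?_, ?_, ?_, ?_, ?_⟩ <;> omega
    obtain ⟨z1, z2, z3, z4, z5, z6⟩ := z
    exact notF H P a1 a2 a3 a4 g
      (by simpa using bz_val H r1 r1 n1) (by simpa using bz_val H r2 r2 n2)
      (by simpa using bz_val H r3 r3 n3) (by simpa using bz_val H r4 r4 n4)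
      (by simpa using bz_val H r1 r2 z1) (by simpa using bz_val H r1 r3 z2)
      (by simpa using bz_val H r1 r4 z3) (by simpa using bz_val H r2 r3 z4)
      (by simpa using bz_val H r2 r4 z5) (by simpa using bz_val H r3 r4 z6)
      C.m1 C.m2 C.m3 C.m4 C.mg sm

lemma not_k1 (H : GoodForm R B) (P : PsiData R B φ Ψ) {a1 a2 a3 a4 g d : V}
    (C : Cfg R B Ψ a1 a2 a3 a4 g d) (n1 : bz B a1 a1 = 4) (n2 : bz B a2 a2 = 2)
    (n3 : bz B a3 a3 = 2) (n4 : bz B a4 a4 = 2) : False := by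
  obtain ⟨⟨-, -, -, -, lg, ld⟩, ⟨q12, q13, q14, q23, q24, q34⟩, s1, s2, s3, s4, sg, sd⟩ := C.ints H P
  have pe := bz_pair H C.mg C.md
  rcases lg with lg | lg
  · rcases ld with ld | ld
    · omega
    · exact not_k1_aux H P C.swapg n1 n2 n3 n4 ld
  · exact not_k1_aux H P C n1 n2 n3 n4 lg

lemma noLong (H : GoodForm R B) (P : PsiData R B φ Ψ) {a1 a2 a3 a4 g d : V}
    (C : Cfg R B Ψ a1 a2 a3 a4 g d) (n1 : bz B a1 a1 = 4) : False := by
  rcases bz_len H (P.sub _ C.m2) with n2 | n2 <;> rcases bz_len H (P.sub _ C.m3) with n3 | n3 <;>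
    rcases bz_len H (P.sub _ C.m4) with n4 | n4
  · exact not_k1 H P C n1 n2 n3 n4
  · exact not_k2 H P C.swap34.swap23 n1 n4 n2 n3
  · exact not_k2 H P C.swap23 n1 n3 n2 n4
  · exact not_k3 H P C.swap23.swap34 n1 n3 n4 n2
  · exact not_k2 H P C n1 n2 n3 n4
  · exact not_k3 H P C.swap34 n1 n2 n4 n3
  · exact not_k3 H P C n1 n2 n3 n4
  · exact not_k4 H P C n1 n2 n3 n4

end Config

/-! ### The remaining configurations: four short roots -/

section ConfigShort

variable {R : Set V} {B : V →ₗ[ℝ] V →ₗ[ℝ] ℝ} {φ : V →ₗ[ℝ] ℝ} {Ψ : Set V}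

/-- `g = a + b` and `d = c + e` with `a ⊥ b` and `c ⊥ e`, all four short. -/
structure Spl (B : V →ₗ[ℝ] V →ₗ[ℝ] ℝ) (a b c e g d : V) : Prop where
  ha : B a a = 2
  hb : B b b = 2
  hc : B c c = 2
  he : B e e = 2
  hab : B a b = 0
  hce : B c e = 0
  hg : g = a + b
  hd : d = c + e

lemma short_long (H : GoodForm R B) (P : PsiData R B φ Ψ) {a1 a2 a3 a4 g d : V}
    (C : Cfg R B Ψ a1 a2 a3 a4 g d) (n1 : bz B a1 a1 = 2) (n2 : bz B a2 a2 = 2)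
    (n3 : bz B a3 a3 = 2) (n4 : bz B a4 a4 = 2) (lg : bz B g g = 4) : bz B d d = 4 := by
  obtain ⟨⟨-, -, -, -, -, ld⟩, ⟨q12, q13, q14, q23, q24, q34⟩, s1, s2, s3, s4, sg, sd⟩ := C.ints H P
  rcases ld with ld | ld
  swap
  · exact ld
  exfalso
  have r1 := P.sub _ C.m1
  have r2 := P.sub _ C.m2
  have r3 := P.sub _ C.m3
  have r4 := P.sub _ C.m4
  have tot : 8 + 2 * (bz B a1 a2 + bz B a1 a3 + bz B a1 a4 + bz B a2 a3 + bz B a2 a4 + bz B a3 a4)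
      = bz B g g + bz B d d + 2 * bz B g d := by linarith
  have E : bz B g d = 2 := by
    have pe := bz_pair H C.mg C.md
    have := pe.2.2.1 lg
    have := pe.2.1
    clear s1 s2 s3 s4 sg sd pe
    omega
  have up : ∀ a ∈ R, bz B a a = 2 → (bz B g a ≤ 2 ∧ bz B g a % 2 = 0) := by
    intro a ra ha
    have := bz_pair H C.mg ra
    have h1 := this.2.2.1 lg
    have h2 := this.2.1
    clear this
    omega
  have g1 := up a1 r1 n1
  have g2 := up a2 r2 n2
  have g3 := up a3 r3 n3
  have g4 := up a4 r4 n4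
  have K : ∀ s t u, s ∈ R → t ∈ R → u ∈ R → bz B s s = 2 → bz B t t = 2 → bz B u u = 2 →
      bz B s t = 0 → bz B g s = 2 → bz B g t = 2 → bz B g u = 2 → bz B s u + bz B t u = 2 := by
    intro s t u rs rt ru hs ht hu hst hgs hgt hgu
    have := short_pair H C.mg rs rt lg hs ht hst hgs hgt
    have e1 := bz_val H C.mg ru hgu
    rw [this, map_add, LinearMap.add_apply, ← bz_cast H rs ru, ← bz_cast H rt ru] at e1
    exact_mod_cast e1
  have T : ∀ s t u, s ∈ R → t ∈ R → u ∈ R → bz B s s = 2 → bz B t t = 2 → bz B u u = 2 →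
      bz B g s = 2 → bz B g t = 2 → bz B g u = 2 → 0 ≤ bz B s t → 0 ≤ bz B s u → 0 ≤ bz B t u →
      bz B s t + bz B s u + bz B t u ≤ 1 → False := by
    intro s t u rs rt ru hs ht hu hgs hgt hgu q1 q2 q3 q4
    by_cases h : bz B s t = 0
    · have := K s t u rs rt ru hs ht hu h hgs hgt hgu
      omega
    · have := K s u t rs ru rt hs hu ht (by omega) hgs hgu hgt
      rw [bz_symm H u t] at this
      omega
  have tot' : bz B a1 a2 + bz B a1 a3 + bz B a1 a4 + bz B a2 a3 + bz B a2 a4 + bz B a3 a4 = 1 := by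
    linarith
  have : (bz B g a1 = 2 ∧ bz B g a2 = 2 ∧ bz B g a3 = 2) ∨
      (bz B g a1 = 2 ∧ bz B g a2 = 2 ∧ bz B g a4 = 2) ∨
      (bz B g a1 = 2 ∧ bz B g a3 = 2 ∧ bz B g a4 = 2) ∨
      (bz B g a2 = 2 ∧ bz B g a3 = 2 ∧ bz B g a4 = 2) := by
    have : bz B g a1 + bz B g a2 + bz B g a3 + bz B g a4 = 6 := by linarith
    clear s1 s2 s3 s4 sg sd tot tot'
    omega
  rcases this with ⟨h1, h2, h3⟩ | ⟨h1, h2, h3⟩ | ⟨h1, h2, h3⟩ | ⟨h1, h2, h3⟩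
  · exact T a1 a2 a3 r1 r2 r3 n1 n2 n3 h1 h2 h3 q12 q13 q23 (by linarith)
  · exact T a1 a2 a4 r1 r2 r4 n1 n2 n4 h1 h2 h3 q12 q14 q24 (by linarith)
  · exact T a1 a3 a4 r1 r3 r4 n1 n3 n4 h1 h2 h3 q13 q14 q34 (by linarith)
  · exact T a2 a3 a4 r2 r3 r4 n2 n3 n4 h1 h2 h3 q23 q24 q34 (by linarith)

/-- The integer bookkeeping in the case of two long roots `g`, `d`. -/
lemma int_split (p12 p13 p14 p23 p24 p34 g1 g2 g3 g4 b1 b2 b3 b4 : ℤ)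
    (q12 : 0 ≤ p12) (q13 : 0 ≤ p13) (q14 : 0 ≤ p14) (q23 : 0 ≤ p23) (q24 : 0 ≤ p24)
    (q34 : 0 ≤ p34) (u1 : g1 ≤ 2 ∧ g1 % 2 = 0) (u2 : g2 ≤ 2 ∧ g2 % 2 = 0)
    (u3 : g3 ≤ 2 ∧ g3 % 2 = 0) (u4 : g4 ≤ 2 ∧ g4 % 2 = 0)
    (v1 : b1 ≤ 2 ∧ b1 % 2 = 0) (v2 : b2 ≤ 2 ∧ b2 % 2 = 0)
    (v3 : b3 ≤ 2 ∧ b3 % 2 = 0) (v4 : b4 ≤ 2 ∧ b4 % 2 = 0)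
    (s1 : g1 + b1 = 2 + p12 + p13 + p14) (s2 : g2 + b2 = p12 + 2 + p23 + p24)
    (s3 : g3 + b3 = p13 + p23 + 2 + p34) (s4 : g4 + b4 = p14 + p24 + p34 + 2)
    (sd : g1 + g2 + g3 + g4 = b1 + b2 + b3 + b4) :
    (p12 = 0 ∧ p34 = 0 ∧ ((g1 = 2 ∧ g2 = 2 ∧ b3 = 2 ∧ b4 = 2) ∨
      (g3 = 2 ∧ g4 = 2 ∧ b1 = 2 ∧ b2 = 2))) ∨
    (p13 = 0 ∧ p24 = 0 ∧ ((g1 = 2 ∧ g3 = 2 ∧ b2 = 2 ∧ b4 = 2) ∨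
      (g2 = 2 ∧ g4 = 2 ∧ b1 = 2 ∧ b3 = 2))) ∨
    (p14 = 0 ∧ p23 = 0 ∧ ((g1 = 2 ∧ g4 = 2 ∧ b2 = 2 ∧ b3 = 2) ∨
      (g2 = 2 ∧ g3 = 2 ∧ b1 = 2 ∧ b4 = 2))) := by
  have key : ∀ g b r : ℤ, g ≤ 2 ∧ g % 2 = 0 → b ≤ 2 ∧ b % 2 = 0 → 0 ≤ r → g + b = 2 + r →
      (g = 2 ∧ b = 0 ∧ r = 0) ∨ (g = 0 ∧ b = 2 ∧ r = 0) ∨ (g = 2 ∧ b = 2 ∧ r = 2) := by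
    intros; omega
  have k1 := key g1 b1 (p12 + p13 + p14) u1 v1 (by linarith) (by linarith)
  have k2 := key g2 b2 (p12 + p23 + p24) u2 v2 (by linarith) (by linarith)
  have k3 := key g3 b3 (p13 + p23 + p34) u3 v3 (by linarith) (by linarith)
  have k4 := key g4 b4 (p14 + p24 + p34) u4 v4 (by linarith) (by linarith)
  clear key u1 u2 u3 u4 v1 v2 v3 v4 s1 s2 s3 s4
  rcases k1 with ⟨rfl, rfl, k1⟩ | ⟨rfl, rfl, k1⟩ | ⟨rfl, rfl, k1⟩ <;>
  rcases k2 with ⟨rfl, rfl, k2⟩ | ⟨rfl, rfl, k2⟩ | ⟨rfl, rfl, k2⟩ <;>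
  rcases k3 with ⟨rfl, rfl, k3⟩ | ⟨rfl, rfl, k3⟩ | ⟨rfl, rfl, k3⟩ <;>
  rcases k4 with ⟨rfl, rfl, k4⟩ | ⟨rfl, rfl, k4⟩ | ⟨rfl, rfl, k4⟩ <;>
  first
  | (exfalso; norm_num at sd; done)
  | (simp; omega)

lemma cfg_cases (H : GoodForm R B) (P : PsiData R B φ Ψ) {a1 a2 a3 a4 g d : V}
    (C : Cfg R B Ψ a1 a2 a3 a4 g d) :
    Spl B a1 a2 a3 a4 g d ∨ Spl B a3 a4 a1 a2 g d ∨ Spl B a1 a3 a2 a4 g d ∨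
    Spl B a2 a4 a1 a3 g d ∨ Spl B a1 a4 a2 a3 g d ∨ Spl B a2 a3 a1 a4 g d := by
  have r1 := P.sub _ C.m1
  have r2 := P.sub _ C.m2
  have r3 := P.sub _ C.m3
  have r4 := P.sub _ C.m4
  have n1 : bz B a1 a1 = 2 := (bz_len H r1).resolve_right (fun h => noLong H P C h)
  have n2 : bz B a2 a2 = 2 := (bz_len H r2).resolve_right (fun h => noLong H P C.swap12 h)
  have n3 : bz B a3 a3 = 2 := (bz_len H r3).resolve_right (fun h => noLong H P C.swap23.swap12 h)
  have n4 : bz B a4 a4 = 2 :=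
    (bz_len H r4).resolve_right (fun h => noLong H P C.swap34.swap23.swap12 h)
  obtain ⟨⟨-, -, -, -, lg, ld⟩, ⟨q12, q13, q14, q23, q24, q34⟩, s1, s2, s3, s4, sg, sd⟩ := C.ints H P
  have pe := (bz_pair H C.mg C.md).2.1
  have lgd : bz B g g = 4 ∧ bz B d d = 4 := by
    rcases lg with lg | lg
    · rcases ld with ld | ld
      · exfalso
        have tot : 8 + 2 * (bz B a1 a2 + bz B a1 a3 + bz B a1 a4 + bz B a2 a3 + bz B a2 a4 +
          bz B a3 a4) = bz B g g + bz B d d + 2 * bz B g d := by linarith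
        have z7 : 2 * bz B g d = bz B g g + bz B d d := by linarith
        have z1 : bz B a1 a2 = 0 := by linarith
        have z2 : bz B a1 a3 = 0 := by linarith
        have z3 : bz B a1 a4 = 0 := by linarith
        have z4 : bz B a2 a3 = 0 := by linarith
        have z5 : bz B a2 a4 = 0 := by linarith
        have z6 : bz B a3 a4 = 0 := by linarith
        exact notD4 H P 2 (by norm_num) a1 a2 a3 a4 g
          (by simpa using bz_val H r1 r1 n1) (by simpa using bz_val H r2 r2 n2)
          (by simpa using bz_val H r3 r3 n3) (by simpa using bz_val H r4 r4 n4)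
          (by simpa using bz_val H r1 r2 z1) (by simpa using bz_val H r1 r3 z2)
          (by simpa using bz_val H r1 r4 z3) (by simpa using bz_val H r2 r3 z4)
          (by simpa using bz_val H r2 r4 z5) (by simpa using bz_val H r3 r4 z6)
          C.m1 C.m2 C.m3 C.m4 C.mg (two_smul_of C.sum (bz_eq H C.mg C.md z7))
      · exact ⟨short_long H P C.swapg n1 n2 n3 n4 ld, ld⟩
    · exact ⟨lg, short_long H P C n1 n2 n3 n4 lg⟩
  obtain ⟨lg, ld⟩ := lgd
  have up : ∀ x ∈ R, bz B x x = 4 → ∀ a ∈ R, bz B a a = 2 → (bz B x a ≤ 2 ∧ bz B x a % 2 = 0) := by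
    intro x rx hx a ra ha
    have := bz_pair H rx ra
    have h1 := this.2.2.1 hx
    have h2 := this.2.1
    clear this
    omega
  have S : ∀ a b c e, a ∈ R → b ∈ R → c ∈ R → e ∈ R → bz B a a = 2 → bz B b b = 2 →
      bz B c c = 2 → bz B e e = 2 → bz B a b = 0 → bz B c e = 0 → bz B g a = 2 → bz B g b = 2 →
      bz B d c = 2 → bz B d e = 2 → Spl B a b c e g d := by
    intro a b c e ra rb rc re na nb nc ne hab hce ga gb dc de
    exact ⟨by simpa using bz_val H ra ra na, by simpa using bz_val H rb rb nb,
      by simpa using bz_val H rc rc nc, by simpa using bz_val H re re ne,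
      by simpa using bz_val H ra rb hab, by simpa using bz_val H rc re hce,
      short_pair H C.mg ra rb lg na nb hab ga gb, short_pair H C.md rc re ld nc ne hce dc de⟩
  have g1 := up g C.mg lg a1 r1 n1
  have g2 := up g C.mg lg a2 r2 n2
  have g3 := up g C.mg lg a3 r3 n3
  have g4 := up g C.mg lg a4 r4 n4
  have b1 := up d C.md ld a1 r1 n1
  have b2 := up d C.md ld a2 r2 n2
  have b3 := up d C.md ld a3 r3 n3
  have b4 := up d C.md ld a4 r4 n4
  rw [n1] at s1
  rw [n2] at s2
  rw [n3] at s3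
  rw [n4] at s4
  rcases int_split _ _ _ _ _ _ _ _ _ _ _ _ _ _ q12 q13 q14 q23 q24 q34 g1 g2 g3 g4 b1 b2 b3 b4
    s1 s2 s3 s4 (by linarith) with ⟨x, y, ⟨h1, h2, h3, h4⟩ | ⟨h1, h2, h3, h4⟩⟩ |
      ⟨x, y, ⟨h1, h2, h3, h4⟩ | ⟨h1, h2, h3, h4⟩⟩ | ⟨x, y, ⟨h1, h2, h3, h4⟩ | ⟨h1, h2, h3, h4⟩⟩
  · exact Or.inl (S _ _ _ _ r1 r2 r3 r4 n1 n2 n3 n4 x y h1 h2 h3 h4)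
  · exact Or.inr (Or.inl (S _ _ _ _ r3 r4 r1 r2 n3 n4 n1 n2 y x h1 h2 h3 h4))
  · exact Or.inr (Or.inr (Or.inl (S _ _ _ _ r1 r3 r2 r4 n1 n3 n2 n4 x y h1 h2 h3 h4)))
  · exact Or.inr (Or.inr (Or.inr (Or.inl (S _ _ _ _ r2 r4 r1 r3 n2 n4 n1 n3 y x h1 h2 h3 h4))))
  · exact Or.inr (Or.inr (Or.inr (Or.inr (Or.inl
      (S _ _ _ _ r1 r4 r2 r3 n1 n4 n2 n3 x y h1 h2 h3 h4)))))
  · exact Or.inr (Or.inr (Or.inr (Or.inr (Or.inr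
      (S _ _ _ _ r2 r3 r1 r4 n2 n3 n1 n4 y x h1 h2 h3 h4)))))

end ConfigShort

/-! ### Symmetrised products of adjoint operators -/

section Sym

variable {E : Type*} [Ring E]

/-- Symmetrised product of three operators. -/
def sym3 (a b c : E) : E := a * b * c + a * c * b + b * a * c + b * c * a + c * a * b + c * b * a

/-- Symmetrised product of four operators. -/
def sym4 (a b c d : E) : E := a * sym3 b c d + b * sym3 a c d + c * sym3 a b d + d * sym3 a b c

lemma sym4_rot (a b c d : E) : sym4 a b c d = sym4 b c d a := by
  simp only [sym4, sym3]; noncomm_ring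

lemma sym4_swap (a b c d : E) : sym4 a b c d = sym4 b a c d := by
  simp only [sym4, sym3]; noncomm_ring

lemma sym4_23 (a b c d : E) : sym4 a b c d = sym4 a c b d := by
  simp only [sym4, sym3]; noncomm_ring

lemma sym4_34 (a b c d : E) : sym4 a b c d = sym4 a b d c := by
  simp only [sym4, sym3]; noncomm_ring

lemma sym3_rot (a b c : E) : sym3 a b c = sym3 b c a := by
  simp only [sym3]; noncomm_ring

lemma sym3_swap (a b c : E) : sym3 a b c = sym3 b a c := by
  simp only [sym3]; noncomm_ring

lemma sym4_add (a a' b c d : E) : sym4 (a + a') b c d = sym4 a b c d + sym4 a' b c d := by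
  simp only [sym4, sym3]; noncomm_ring

lemma sym4_smul {k : Type*} [CommRing k] [Algebra k E] (t : k) (a b c d : E) :
    sym4 (t • a) b c d = t • sym4 a b c d := by
  simp only [sym4, sym3, smul_mul_assoc, mul_smul_comm, smul_add, mul_add]

lemma sym3_smul {k : Type*} [CommRing k] [Algebra k E] (t : k) (a b c : E) :
    sym3 a b (t • c) = t • sym3 a b c := by
  simp only [sym3, smul_mul_assoc, mul_smul_comm, smul_add, mul_add]

lemma sym4_self (a : E) : sym4 a a a a = 24 * a ^ 4 := by
  simp only [sym4, sym3]; noncomm_ring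

lemma comm_cube (z a b : E) (h : z * a - a * z = b) (h3 : a * a * a = 0) :
    a * a * b + a * b * a + b * a * a = 0 := by
  have : a * a * b + a * b * a + b * a * a = z * (a * a * a) - (a * a * a) * z := by
    rw [← h]; noncomm_ring
  rw [this, h3]; simp

lemma comm_sym3 (w a b c : E) (h : w * a - a * w = c) (hb : w * b - b * w = 0)
    (h3 : a * a * b + a * b * a + b * a * a = 0) : sym3 a b c = 0 := by
  have hb' : w * b = b * w := sub_eq_zero.1 hb
  have e : sym3 a b c = w * (a * a * b + a * b * a + b * a * a)
      - (a * a * b + a * b * a + b * a * a) * w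
      - (a * a * (w * b - b * w) + a * (w * b - b * w) * a + (w * b - b * w) * a * a) := by
    rw [← h]; simp only [sym3]; noncomm_ring
  rw [e, h3, hb]; simp

end Sym

/-! ### The grading of `L` -/

section LiePart

variable {L : Type*} [LieRing L] [LieAlgebra ℂ L]

open Classical in
/-- The weight space of weight `v`. -/
def wsp (D : LieRootData V L) (v : V) : Submodule ℂ L :=
  if v ∈ D.roots then D.rs v else if v = 0 then D.cartan.toSubmodule else ⊥

lemma wsp_root (D : LieRootData V L) {v : V} (h : v ∈ D.roots) : wsp D v = D.rs v := by
  simp [wsp, h]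

lemma wsp_zero (D : LieRootData V L) : wsp D 0 = D.cartan.toSubmodule := by
  have : (0 : V) ∉ D.roots := fun h => D.ne_zero _ h rfl
  simp [wsp, this]

lemma wsp_bot (D : LieRootData V L) {v : V} (h : v ∉ D.roots) (h0 : v ≠ 0) : wsp D v = ⊥ := by
  simp [wsp, h, h0]

lemma wsp_ad (D : LieRootData V L) {a v : V} (ha : a ∈ D.roots) {x y : L} (hx : x ∈ D.rs a)
    (hy : y ∈ wsp D v) : LieAlgebra.ad ℂ L x y ∈ wsp D (v + a) := by
  rw [LieAlgebra.ad_apply]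
  by_cases hv : v ∈ D.roots
  · rw [wsp_root D hv] at hy
    by_cases hva : v + a ∈ D.roots
    · rw [wsp_root D hva, add_comm]
      exact D.bracket_mem a ha v hv (by rwa [add_comm]) x hx y hy
    · by_cases h0 : v + a = 0
      · rw [h0, wsp_zero]
        have : v = -a := eq_neg_of_add_eq_zero_left h0
        subst this
        exact D.bracket_cartan_mem a ha x hx y hy
      · rw [D.bracket_eq_zero a ha v hv (by rwa [add_comm]) (by rwa [add_comm]) x hx y hy]
        exact Submodule.zero_mem _
  · by_cases h0 : v = 0
    · subst h0
      rw [wsp_zero] at hy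
      rw [zero_add, wsp_root D ha, ← lie_skew]
      obtain ⟨c, hc⟩ := D.weight_vec a ha y hy x hx
      rw [hc]
      exact Submodule.neg_mem _ (Submodule.smul_mem _ _ hx)
    · rw [wsp_bot D hv h0, Submodule.mem_bot] at hy
      rw [hy, lie_zero]
      exact Submodule.zero_mem _

lemma sym3_wsp (D : LieRootData V L) {a b c v : V} (ha : a ∈ D.roots) (hb : b ∈ D.roots)
    (hc : c ∈ D.roots) {x y z u : L} (hx : x ∈ D.rs a) (hy : y ∈ D.rs b) (hz : z ∈ D.rs c)
    (hu : u ∈ wsp D v) :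
    sym3 (LieAlgebra.ad ℂ L x) (LieAlgebra.ad ℂ L y) (LieAlgebra.ad ℂ L z) u
      ∈ wsp D (v + a + b + c) := by
  have M : ∀ a b c : V, a ∈ D.roots → b ∈ D.roots → c ∈ D.roots → ∀ x ∈ D.rs a, ∀ y ∈ D.rs b,
      ∀ z ∈ D.rs c, ∀ s, v + c + b + a = s →
      LieAlgebra.ad ℂ L x (LieAlgebra.ad ℂ L y (LieAlgebra.ad ℂ L z u)) ∈ wsp D s := by
    intro a b c ha hb hc x hx y hy z hz s hs
    rw [← hs]
    exact wsp_ad D ha hx (wsp_ad D hb hy (wsp_ad D hc hz hu))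
  simp only [sym3, LinearMap.add_apply, Module.End.mul_apply]
  refine Submodule.add_mem _ (Submodule.add_mem _ (Submodule.add_mem _ (Submodule.add_mem _
    (Submodule.add_mem _ ?_ ?_) ?_) ?_) ?_) ?_
  · exact M a b c ha hb hc _ hx _ hy _ hz _ (by abel)
  · exact M a c b ha hc hb _ hx _ hz _ hy _ (by abel)
  · exact M b a c hb ha hc _ hy _ hx _ hz _ (by abel)
  · exact M b c a hb hc ha _ hy _ hz _ hx _ (by abel)
  · exact M c a b hc ha hb _ hz _ hx _ hy _ (by abel)
  · exact M c b a hc hb ha _ hz _ hy _ hx _ (by abel)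

lemma sym4_wsp (D : LieRootData V L) {a b c d v : V} (ha : a ∈ D.roots) (hb : b ∈ D.roots)
    (hc : c ∈ D.roots) (hd : d ∈ D.roots) {x y z w u : L} (hx : x ∈ D.rs a) (hy : y ∈ D.rs b)
    (hz : z ∈ D.rs c) (hw : w ∈ D.rs d) (hu : u ∈ wsp D v) :
    sym4 (LieAlgebra.ad ℂ L x) (LieAlgebra.ad ℂ L y) (LieAlgebra.ad ℂ L z) (LieAlgebra.ad ℂ L w) u
      ∈ wsp D (v + (a + b + c + d)) := by
  simp only [sym4, LinearMap.add_apply, Module.End.mul_apply]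
  refine Submodule.add_mem _ (Submodule.add_mem _ (Submodule.add_mem _ ?_ ?_) ?_) ?_
  · convert wsp_ad D ha hx (sym3_wsp D hb hc hd hy hz hw hu) using 2; abel
  · convert wsp_ad D hb hy (sym3_wsp D ha hc hd hx hz hw hu) using 2; abel
  · convert wsp_ad D hc hz (sym3_wsp D ha hb hd hx hy hw hu) using 2; abel
  · convert wsp_ad D hd hw (sym3_wsp D ha hb hc hx hy hz hu) using 2; abel

/-- Two operators agreeing with zero on the Cartan subalgebra and root spaces vanish. -/
lemma op_eq_zero (D : LieRootData V L) (T : Module.End ℂ L)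
    (h : ∀ v, (v = 0 ∨ v ∈ D.roots) → ∀ u ∈ wsp D v, T u = 0) : T = 0 := by
  have hk : (⊤ : Submodule ℂ L) ≤ LinearMap.ker T := by
    rw [← D.sup_eq_top]
    refine sup_le ?_ (iSup₂_le ?_)
    · intro u hu
      exact h 0 (Or.inl rfl) u (by rw [wsp_zero]; exact hu)
    · intro a ha u hu
      exact h a (Or.inr ha) u (by rw [wsp_root D ha]; exact hu)
  exact LinearMap.ker_eq_top.1 (top_le_iff.1 hk)

lemma exists_br (D : LieRootData V L) {u v w : V} (hu : u ∈ D.roots) (hv : v ∈ D.roots)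
    (hw : w ∈ D.roots) (huv : u + v = w) {x y : L} (hx : x ∈ D.rs v) (hx0 : x ≠ 0)
    (hy : y ∈ D.rs w) : ∃ z ∈ D.rs u, ⁅z, x⁆ = y := by
  have hd := D.rs_dim u hu
  obtain ⟨⟨z0, hz0⟩, hz0', -⟩ := finrank_eq_one_iff'.1 hd
  have hz00 : z0 ≠ 0 := fun h => hz0' (by simpa using h)
  have hne := D.bracket_ne_zero u hu v hv (huv ▸ hw) z0 hz0 hz00 x hx hx0
  have hmem := D.bracket_mem u hu v hv (huv ▸ hw) z0 hz0 x hx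
  rw [huv] at hmem
  obtain ⟨c, hc⟩ := exists_smul_eq_of_finrank_eq_one (D.rs_dim w hw)
    (x := (⟨⁅z0, x⁆, hmem⟩ : D.rs w)) (fun h => hne (by simpa using h)) ⟨y, hy⟩
  refine ⟨c • z0, Submodule.smul_mem _ _ hz0, ?_⟩
  rw [smul_lie]
  simpa using congrArg Subtype.val hc

lemma exists_scalar (D : LieRootData V L) {w : V} (hw : w ∈ D.roots) {x y : L} (hx : x ∈ D.rs w)
    (hx0 : x ≠ 0) (hy : y ∈ D.rs w) : ∃ c : ℂ, y = c • x := by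
  obtain ⟨c, hc⟩ := exists_smul_eq_of_finrank_eq_one (D.rs_dim w hw)
    (x := (⟨x, hx⟩ : D.rs w)) (fun h => hx0 (by simpa using h)) ⟨y, hy⟩
  exact ⟨c, by simpa using (congrArg Subtype.val hc).symm⟩

lemma ad_comm (z x : L) : LieAlgebra.ad ℂ L z * LieAlgebra.ad ℂ L x -
    LieAlgebra.ad ℂ L x * LieAlgebra.ad ℂ L z = LieAlgebra.ad ℂ L ⁅z, x⁆ := by
  ext u
  simp only [LinearMap.sub_apply, Module.End.mul_apply, LieAlgebra.ad_apply, lie_lie]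

variable {B : V →ₗ[ℝ] V →ₗ[ℝ] ℝ}

lemma cube_zero (D : LieRootData V L) (H : GoodForm D.roots B) {a : V} (ha : a ∈ D.roots)
    (hs : B a a = 2) {x : L} (hx : x ∈ D.rs a) :
    LieAlgebra.ad ℂ L x * LieAlgebra.ad ℂ L x * LieAlgebra.ad ℂ L x = 0 := by
  refine op_eq_zero D _ fun v hv u hu => ?_
  have h := wsp_ad D ha hx (wsp_ad D ha hx (wsp_ad D ha hx hu))
  have hn : 4 < B (v + a + a + a) (v + a + a + a) := by
    simp only [map_add, LinearMap.add_apply, hs, H.symm a v]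
    rcases hv with rfl | hv
    · simp; norm_num
    · have hb := form_bound H v a
      have hl := H.len v hv
      obtain ⟨n, hn⟩ := H.int v hv a ha
      have : -3 ≤ B v a := by rcases hl with h | h <;> rw [h, hs] at hb <;> linarith
      rcases hl with h | h
      · rw [h, hs] at hb; rw [h]; linarith
      · obtain ⟨m, hm⟩ := H.even v hv a ha h
        have : (-2 : ℝ) < m := by linarith
        have : (-2 : ℤ) < m := by exact_mod_cast this
        have : (-1 : ℤ) ≤ m := by omega
        have : (-1 : ℝ) ≤ m := by exact_mod_cast this
        rw [h]; linarith
  rw [wsp_bot D (not_root H hn) (by rintro h0; rw [h0] at hn; simp at hn; linarith),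
    Submodule.mem_bot] at h
  simpa [Module.End.mul_apply] using h

/-- `a`, `b` short orthogonal roots with `a + b` a root. -/
structure Adj (R : Set V) (B : V →ₗ[ℝ] V →ₗ[ℝ] ℝ) (a b : V) : Prop where
  ha : a ∈ R
  hb : b ∈ R
  sa : B a a = 2
  sb : B b b = 2
  ab : B a b = 0
  add : a + b ∈ R

lemma Adj.symm {R : Set V} (H : GoodForm R B) {a b : V} (h : Adj R B a b) : Adj R B b a :=
  ⟨h.hb, h.ha, h.sb, h.sa, by rw [H.symm]; exact h.ab, by rw [add_comm]; exact h.add⟩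

lemma Adj.sub {R : Set V} (H : GoodForm R B) {a b : V} (h : Adj R B a b) : b - a ∈ R := by
  have := H.refl_s _ h.add _ h.ha h.sa
  rw [map_add, LinearMap.add_apply, h.sa, H.symm b a, h.ab] at this
  convert this using 1; module

lemma sym3_aab (D : LieRootData V L) (H : GoodForm D.roots B) {a b : V} (h : Adj D.roots B a b)
    {x y : L} (hx : x ∈ D.rs a) (hx0 : x ≠ 0) (hy : y ∈ D.rs b) :
    LieAlgebra.ad ℂ L x * LieAlgebra.ad ℂ L x * LieAlgebra.ad ℂ L y +
    LieAlgebra.ad ℂ L x * LieAlgebra.ad ℂ L y * LieAlgebra.ad ℂ L x +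
    LieAlgebra.ad ℂ L y * LieAlgebra.ad ℂ L x * LieAlgebra.ad ℂ L x = 0 := by
  obtain ⟨z, hz, hzx⟩ := exists_br D (h.sub H) h.ha h.hb (by abel) hx hx0 hy
  exact comm_cube (LieAlgebra.ad ℂ L z) _ _ (by rw [ad_comm, hzx]) (cube_zero D H h.ha h.sa hx)

lemma sym3_T (D : LieRootData V L) (H : GoodForm D.roots B) {a b c : V} (h : Adj D.roots B a b)
    (hc : c ∈ D.roots) (hcond : c = a ∨ (c - a ∈ D.roots ∧ 4 < B (c - a + b) (c - a + b)))
    {x y z : L} (hx : x ∈ D.rs a) (hy : y ∈ D.rs b) (hz : z ∈ D.rs c) :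
    sym3 (LieAlgebra.ad ℂ L x) (LieAlgebra.ad ℂ L y) (LieAlgebra.ad ℂ L z) = 0 := by
  by_cases hx0 : x = 0
  · subst hx0; simp [sym3]
  have h3 := sym3_aab D H h hx hx0 hy
  rcases hcond with rfl | ⟨hca, hn⟩
  · obtain ⟨t, ht⟩ := exists_scalar D h.ha hx hx0 hz
    rw [ht, map_smul, sym3_smul]
    have : sym3 (LieAlgebra.ad ℂ L x) (LieAlgebra.ad ℂ L y) (LieAlgebra.ad ℂ L x) =
      2 * (LieAlgebra.ad ℂ L x * LieAlgebra.ad ℂ L x * LieAlgebra.ad ℂ L y +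
    LieAlgebra.ad ℂ L x * LieAlgebra.ad ℂ L y * LieAlgebra.ad ℂ L x +
    LieAlgebra.ad ℂ L y * LieAlgebra.ad ℂ L x * LieAlgebra.ad ℂ L x) := by
      simp only [sym3]; noncomm_ring
    rw [this, h3]; simp
  · obtain ⟨w, hw, hwx⟩ := exists_br D hca h.ha hc (by abel) hx hx0 hz
    refine comm_sym3 (LieAlgebra.ad ℂ L w) _ _ _ (by rw [ad_comm, hwx]) ?_ h3
    rw [ad_comm, D.bracket_eq_zero _ hca _ h.hb (not_root H hn)
      (by intro h0; rw [h0] at hn; simp at hn; linarith) w hw y hy, map_zero]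

end LiePart

/-! ### Vanishing of the symmetrised products -/

section Vanish

variable {L : Type*} [LieRing L] [LieAlgebra ℂ L]
variable {B : V →ₗ[ℝ] V →ₗ[ℝ] ℝ} {φ : V →ₗ[ℝ] ℝ} {Ψ : Set V}

lemma cross {R : Set V} (H : GoodForm R B) {a b c e : V} (h1 : Adj R B a b) (h2 : Adj R B c e)
    (hac : B a c = 0) (hae : B a e = 0) (hbc : B b c = 0) (hbe : B b e = 0) (h : a + c ∈ R) :
    a + e ∈ R ∧ b + c ∈ R := by
  have hA : Adj R B a c := ⟨h1.ha, h2.ha, h1.sa, h2.sa, hac, h⟩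
  have s1 := hA.sub H
  have s2 := (hA.symm H).sub H
  have e1 := h1.sa
  have e2 := h1.sb
  have e3 := h1.ab
  have e4 := h2.sa
  have e5 := h2.sb
  have e6 := h2.ab
  have y1 := H.symm b a
  have y2 := H.symm c a
  have y3 := H.symm e a
  have y4 := H.symm e c
  have y5 := H.symm c b
  constructor
  · exact root_sub' H _ h2.add s1 (by abel)
      (by simp only [map_add, map_sub, LinearMap.add_apply, LinearMap.sub_apply]; linarith)
      (by simp only [map_add, map_sub, LinearMap.add_apply, LinearMap.sub_apply]; linarith)
  · exact root_sub' H _ h1.add s2 (by abel)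
      (by simp only [map_add, map_sub, LinearMap.add_apply, LinearMap.sub_apply]; linarith)
      (by simp only [map_add, map_sub, LinearMap.add_apply, LinearMap.sub_apply]; linarith)

/-- If the four triple products vanish so does the quadruple product. -/
lemma sym4_of {E : Type*} [Ring E] {a b c e : E} (h1 : sym3 a b c = 0) (h2 : sym3 a b e = 0)
    (h3 : sym3 c e a = 0) (h4 : sym3 c e b = 0) : sym4 a b c e = 0 := by
  rw [← sym3_rot] at h3 h4
  simp [sym4, h1, h2, h3, h4]

lemma spl_zero_same (D : LieRootData V L) (H : GoodForm D.roots B) {a b e : V}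
    (h1 : Adj D.roots B a b) (h2 : Adj D.roots B a e) (hbe : B b e = 0 ∨ b = e)
    {xa xb xc xe : L} (ha : xa ∈ D.rs a) (hb : xb ∈ D.rs b) (hc : xc ∈ D.rs a)
    (he : xe ∈ D.rs e) :
    sym4 (LieAlgebra.ad ℂ L xa) (LieAlgebra.ad ℂ L xb) (LieAlgebra.ad ℂ L xc)
      (LieAlgebra.ad ℂ L xe) = 0 := by
  have e1 := h1.sa
  have e2 := h1.sb
  have e3 := h1.ab
  have e5 := h2.sb
  have e6 := h2.ab
  have y1 := H.symm b a
  have y3 := H.symm e a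
  have y4 := H.symm e b
  have tri : ∀ x ∈ D.rs a, sym3 (LieAlgebra.ad ℂ L x) (LieAlgebra.ad ℂ L xb)
      (LieAlgebra.ad ℂ L xe) = 0 := by
    intro x hx
    rcases hbe with hbe | hbe
    · refine sym3_T D H h1 h2.hb (Or.inr ⟨h2.sub H, ?_⟩) hx hb he
      simp only [map_add, map_sub, LinearMap.add_apply, LinearMap.sub_apply]; linarith
    · rw [sym3_swap]
      exact sym3_T D H (h1.symm H) h2.hb (Or.inl hbe.symm) hb hx he
  refine sym4_of (sym3_T D H h1 h1.ha (Or.inl rfl) ha hb hc) (tri _ ha)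
    (sym3_T D H h2 h2.ha (Or.inl rfl) hc he ha) ?_
  rw [← sym3_rot, sym3_swap]
  exact tri _ hc

lemma int_spl {p q r s k1 k2 k3 k4 : ℤ} (p0 : 0 ≤ p) (p2 : p ≤ 2) (q0 : 0 ≤ q) (q2 : q ≤ 2)
    (r0 : 0 ≤ r) (r2 : r ≤ 2) (s0 : 0 ≤ s) (s2 : s ≤ 2) (i1 : p + r = 2 * k1) (j1 : k1 ≤ 1)
    (i2 : q + s = 2 * k2) (j2 : k2 ≤ 1) (i3 : p + q = 2 * k3) (j3 : k3 ≤ 1)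
    (i4 : r + s = 2 * k4) (j4 : k4 ≤ 1) :
    (p = 0 ∧ q = 0 ∧ r = 0 ∧ s = 0) ∨ (p = 1 ∧ q = 1 ∧ r = 1 ∧ s = 1) ∨
      (p = 2 ∧ q = 0 ∧ r = 0 ∧ (s = 0 ∨ s = 2)) ∨ (q = 2 ∧ p = 0 ∧ s = 0 ∧ (r = 0 ∨ r = 2)) ∨
      (r = 2 ∧ p = 0 ∧ s = 0 ∧ q = 0) ∨ (s = 2 ∧ q = 0 ∧ r = 0 ∧ p = 0) := by
  interval_cases p <;> interval_cases q <;> first | (exfalso; omega) | skip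
  all_goals interval_cases r <;> interval_cases s <;> first | (exfalso; omega) | simp

set_option maxHeartbeats 1000000 in
/-- Vanishing for a split configuration. -/
lemma spl_zero (D : LieRootData V L) (H : GoodForm D.roots B) (P : PsiData D.roots B φ Ψ)
    {a b c e g d : V} (ma : a ∈ Ψ) (mb : b ∈ Ψ) (mc : c ∈ Ψ) (me : e ∈ Ψ)
    (hg : g ∈ D.roots) (hd : d ∈ D.roots) (S : Spl B a b c e g d)
    {xa xb xc xe u : L} (ha : xa ∈ D.rs a) (hb : xb ∈ D.rs b) (hc : xc ∈ D.rs c)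
    (he : xe ∈ D.rs e) (hu : u ∈ D.rs (-d)) :
    sym4 (LieAlgebra.ad ℂ L xa) (LieAlgebra.ad ℂ L xb) (LieAlgebra.ad ℂ L xc)
      (LieAlgebra.ad ℂ L xe) u = 0 := by
  have ra := P.sub _ ma
  have rb := P.sub _ mb
  have rc := P.sub _ mc
  have re := P.sub _ me
  have h1 : Adj D.roots B a b := ⟨ra, rb, S.ha, S.hb, S.hab, S.hg ▸ hg⟩
  have h2 : Adj D.roots B c e := ⟨rc, re, S.hc, S.he, S.hce, S.hd ▸ hd⟩
  have e1 := h1.sa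
  have e2 := h1.sb
  have e3 := h1.ab
  have e4 := h2.sa
  have e5 := h2.sb
  have e6 := h2.ab
  have y1 := H.symm b a
  have y2 := H.symm c a
  have y3 := H.symm e a
  have y4 := H.symm e c
  have y5 := H.symm c b
  have y6 := H.symm e b
  have lg : B g g = 4 := by
    rw [S.hg]; simp only [map_add, LinearMap.add_apply]; linarith
  have ld : B d d = 4 := by
    rw [S.hd]; simp only [map_add, LinearMap.add_apply]; linarith
  -- integer bookkeeping
  have I : (bz B a c = 0 ∧ bz B a e = 0 ∧ bz B b c = 0 ∧ bz B b e = 0) ∨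
      (bz B a c = 1 ∧ bz B a e = 1 ∧ bz B b c = 1 ∧ bz B b e = 1) ∨
      (bz B a c = 2 ∧ bz B a e = 0 ∧ bz B b c = 0 ∧ (bz B b e = 0 ∨ bz B b e = 2)) ∨
      (bz B a e = 2 ∧ bz B a c = 0 ∧ bz B b e = 0 ∧ (bz B b c = 0 ∨ bz B b c = 2)) ∨
      (bz B b c = 2 ∧ bz B a c = 0 ∧ bz B b e = 0 ∧ bz B a e = 0) ∨
      (bz B b e = 2 ∧ bz B a e = 0 ∧ bz B b c = 0 ∧ bz B a c = 0) := by
    have nn : ∀ x ∈ Ψ, ∀ y ∈ Ψ, B x x = 2 → B y y = 2 → 0 ≤ bz B x y ∧ bz B x y ≤ 2 := by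
      intro x hx y hy h h'
      have h1 := P.nn _ hx _ hy
      have h2 := (form_bound H x y).2
      rw [← bz_cast H (P.sub _ hx) (P.sub _ hy)] at h1 h2
      rw [h, h'] at h2
      have h3 : (bz B x y : ℝ) ≤ 2 := by linarith
      exact ⟨by exact_mod_cast h1, by exact_mod_cast h3⟩
    have ev : ∀ r s t u, r ∈ D.roots → B r r = 4 → s ∈ D.roots → t ∈ D.roots → u ∈ D.roots →
        r = s + t → B u u = 2 → ∃ n : ℤ, bz B s u + bz B t u = 2 * n ∧ n ≤ 1 := by
      intro r s t u hr hl hs ht hu hst huu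
      obtain ⟨n, hn⟩ := H.even r hr u hu hl
      have h2 := (form_bound H r u).2
      rw [hl, huu, hn] at h2
      rw [hst, map_add, LinearMap.add_apply, ← bz_cast H hs hu, ← bz_cast H ht hu] at hn
      have h3 : (n : ℝ) < 2 := by linarith
      have h4 : n < 2 := by exact_mod_cast h3
      exact ⟨n, by exact_mod_cast hn, by omega⟩
    obtain ⟨k1, i1, j1⟩ := ev g a b c hg lg ra rb rc S.hg e4
    obtain ⟨k2, i2, j2⟩ := ev g a b e hg lg ra rb re S.hg e5
    obtain ⟨k3, i3, j3⟩ := ev d c e a hd ld rc re ra S.hd e1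
    obtain ⟨k4, i4, j4⟩ := ev d c e b hd ld rc re rb S.hd e2
    rw [bz_symm H c a, bz_symm H e a] at i3
    rw [bz_symm H c b, bz_symm H e b] at i4
    have t1 := nn a ma c mc e1 e4
    have t2 := nn a ma e me e1 e5
    have t3 := nn b mb c mc e2 e4
    have t4 := nn b mb e me e2 e5
    exact int_spl t1.1 t1.2 t2.1 t2.2 t3.1 t3.2 t4.1 t4.2 i1 j1 i2 j2 i3 j3 i4 j4
  have eqq : ∀ x ∈ D.roots, ∀ y ∈ D.roots, B x x = 2 → B y y = 2 → bz B x y = 2 → x = y := by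
    intro x hx y hy h h' h2
    rw [← bz_cast H hx hx] at h
    rw [← bz_cast H hy hy] at h'
    have : bz B x x = 2 := by exact_mod_cast h
    have : bz B y y = 2 := by exact_mod_cast h'
    exact bz_eq H hx hy (by omega)
  have z0 : ∀ x ∈ D.roots, ∀ y ∈ D.roots, bz B x y = 0 → B x y = 0 := by
    intro x hx y hy h
    simpa using bz_val H hx hy h
  have z01 : ∀ x ∈ D.roots, ∀ y ∈ D.roots, B x x = 2 → B y y = 2 →
      (bz B x y = 0 ∨ bz B x y = 2) → (B x y = 0 ∨ x = y) := by
    intro x hx y hy h h' h2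
    rcases h2 with h2 | h2
    · exact Or.inl (z0 x hx y hy h2)
    · exact Or.inr (eqq x hx y hy h h' h2)
  rcases I with ⟨i1, i2, i3, i4⟩ | ⟨i1, i2, i3, i4⟩ | ⟨i1, i2, i3, i4⟩ | ⟨i1, i2, i3, i4⟩ |
    ⟨i1, i2, i3, i4⟩ | ⟨i1, i2, i3, i4⟩
  · have f1 := z0 a ra c rc i1
    have f2 := z0 a ra e re i2
    have f3 := z0 b rb c rc i3
    have f4 := z0 b rb e re i4
    by_cases hac : a + c ∈ D.roots
    · obtain ⟨hae, hbc⟩ := cross H h1 h2 f1 f2 f3 f4 hac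
      have Aac : Adj D.roots B a c := ⟨ra, rc, e1, e4, f1, hac⟩
      have Aae : Adj D.roots B a e := ⟨ra, re, e1, e5, f2, hae⟩
      have Abc : Adj D.roots B b c := ⟨rb, rc, e2, e4, f3, hbc⟩
      rw [sym4_of]
      · rfl
      · refine sym3_T D H h1 rc (Or.inr ⟨Aac.sub H, ?_⟩) ha hb hc
        simp only [map_add, map_sub, LinearMap.add_apply, LinearMap.sub_apply]; linarith
      · refine sym3_T D H h1 re (Or.inr ⟨Aae.sub H, ?_⟩) ha hb he
        simp only [map_add, map_sub, LinearMap.add_apply, LinearMap.sub_apply]; linarith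
      · refine sym3_T D H h2 ra (Or.inr ⟨(Aac.symm H).sub H, ?_⟩) hc he ha
        simp only [map_add, map_sub, LinearMap.add_apply, LinearMap.sub_apply]; linarith
      · refine sym3_T D H h2 rb (Or.inr ⟨(Abc.symm H).sub H, ?_⟩) hc he hb
        simp only [map_add, map_sub, LinearMap.add_apply, LinearMap.sub_apply]; linarith
    · have hae : a + e ∉ D.roots := fun h =>
        hac (cross H h1 (h2.symm H) f2 f1 f4 f3 h).1
      have hbc : b + c ∉ D.roots := fun h =>
        hac (cross H (h1.symm H) h2 f3 f4 f1 f2 h).2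
      have hbe : b + e ∉ D.roots := fun h =>
        hae (cross H (h1.symm H) (h2.symm H) f4 f3 f2 f1 h).2
      have ne0 : ∀ x y, B x x = 2 → B y y = 2 → B x y = 0 → x + y ≠ 0 := by
        intro x y h h' h'' h0
        have : B (x + y) (x + y) = 4 := by
          simp only [map_add, LinearMap.add_apply, H.symm y x]; linarith
        rw [h0] at this
        simp at this
      have cm : ∀ x ∈ D.roots, ∀ y ∈ D.roots, x + y ∉ D.roots → x + y ≠ 0 → ∀ p ∈ D.rs x,
          ∀ q ∈ D.rs y, ∀ v : L, ⁅p, ⁅q, v⁆⁆ = ⁅q, ⁅p, v⁆⁆ := by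
        intro x hx y hy hxy h0 p hp q hq v
        rw [leibniz_lie, D.bracket_eq_zero x hx y hy hxy h0 p hp q hq, zero_lie, zero_add]
      have c1 := cm a ra c rc hac (ne0 _ _ e1 e4 f1) xa ha xc hc
      have c2 := cm a ra e re hae (ne0 _ _ e1 e5 f2) xa ha xe he
      have c3 := cm b rb c rc hbc (ne0 _ _ e2 e4 f3) xb hb xc hc
      have c4 := cm b rb e re hbe (ne0 _ _ e2 e5 f4) xb hb xe he
      have rd := H.neg _ hd
      have kill : ∀ x ∈ D.roots, B x x = 2 → B x c = 0 → B x e = 0 → ∀ p ∈ D.rs x,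
          ⁅p, u⁆ = 0 := by
        intro x hx h h' h'' p hp
        have hn : 4 < B (x + -d) (x + -d) := by
          rw [S.hd]
          have := H.symm c x
          have := H.symm e x
          simp only [map_add, map_neg, LinearMap.neg_apply, LinearMap.add_apply]
          linarith
        exact D.bracket_eq_zero x hx _ rd (not_root H hn)
          (by intro h0; rw [h0] at hn; simp at hn; linarith) p hp u hu
      have k1 := kill a ra e1 f1 f2 xa ha
      have k2 := kill b rb e2 f3 f4 xb hb
      simp only [sym4, sym3, LinearMap.add_apply, Module.End.mul_apply, map_add,
        LieAlgebra.ad_apply, c1, c2, c3, c4, k1, k2, lie_zero, add_zero]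
  · have f1 : B a c = 1 := by simpa using bz_val H ra rc i1
    have f2 : B a e = 1 := by simpa using bz_val H ra re i2
    have f3 : B b c = 1 := by simpa using bz_val H rb rc i3
    have f4 : B b e = 1 := by simpa using bz_val H rb re i4
    rw [sym4_of]
    · rfl
    · refine sym3_T D H h1 rc (Or.inr ⟨root_sub' H _ rc ra rfl (by linarith) (by linarith), ?_⟩)
        ha hb hc
      simp only [map_add, map_sub, LinearMap.add_apply, LinearMap.sub_apply]; linarith
    · refine sym3_T D H h1 re (Or.inr ⟨root_sub' H _ re ra rfl (by linarith) (by linarith), ?_⟩)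
        ha hb he
      simp only [map_add, map_sub, LinearMap.add_apply, LinearMap.sub_apply]; linarith
    · refine sym3_T D H h2 ra (Or.inr ⟨root_sub' H _ ra rc rfl (by linarith) (by linarith), ?_⟩)
        hc he ha
      simp only [map_add, map_sub, LinearMap.add_apply, LinearMap.sub_apply]; linarith
    · refine sym3_T D H h2 rb (Or.inr ⟨root_sub' H _ rb rc rfl (by linarith) (by linarith), ?_⟩)
        hc he hb
      simp only [map_add, map_sub, LinearMap.add_apply, LinearMap.sub_apply]; linarith
  · have := eqq a ra c rc e1 e4 i1
    subst this
    rw [spl_zero_same D H h1 h2 (z01 b rb e re e2 e5 i4) ha hb hc he]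
    rfl
  · have := eqq a ra e re e1 e5 i1
    subst this
    rw [sym4_34, spl_zero_same D H h1 (h2.symm H) (z01 b rb c rc e2 e4 i4) ha hb he hc]
    rfl
  · have := eqq b rb c rc e2 e4 i1
    subst this
    rw [sym4_swap, spl_zero_same D H (h1.symm H) h2 (Or.inl (z0 a ra e re i4)) hb ha hc he]
    rfl
  · have := eqq b rb e re e2 e5 i1
    subst this
    rw [sym4_swap, sym4_34,
      spl_zero_same D H (h1.symm H) (h2.symm H) (Or.inl (z0 a ra c rc i4)) hb ha he hc]
    rfl

lemma sym4_zero (D : LieRootData V L) (H : GoodForm D.roots B) (P : PsiData D.roots B φ Ψ)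
    {a1 a2 a3 a4 : V} (m1 : a1 ∈ Ψ) (m2 : a2 ∈ Ψ) (m3 : a3 ∈ Ψ) (m4 : a4 ∈ Ψ)
    {x1 x2 x3 x4 : L} (h1 : x1 ∈ D.rs a1) (h2 : x2 ∈ D.rs a2) (h3 : x3 ∈ D.rs a3)
    (h4 : x4 ∈ D.rs a4) :
    sym4 (LieAlgebra.ad ℂ L x1) (LieAlgebra.ad ℂ L x2) (LieAlgebra.ad ℂ L x3)
      (LieAlgebra.ad ℂ L x4) = 0 := by
  have r1 := P.sub _ m1
  have r2 := P.sub _ m2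
  have r3 := P.sub _ m3
  have r4 := P.sub _ m4
  have hN : 4 < B (a1 + a2 + a3 + a4) (a1 + a2 + a3 + a4) := by
    have l : ∀ a ∈ D.roots, 2 ≤ B a a := by
      intro a ha; rcases H.len a ha with h | h <;> linarith
    have := l _ r1
    have := l _ r2
    have := l _ r3
    have := l _ r4
    have := P.nn _ m1 _ m2
    have := P.nn _ m1 _ m3
    have := P.nn _ m1 _ m4
    have := P.nn _ m2 _ m3
    have := P.nn _ m2 _ m4
    have := P.nn _ m3 _ m4
    have := H.symm a2 a1
    have := H.symm a3 a1
    have := H.symm a4 a1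
    have := H.symm a3 a2
    have := H.symm a4 a2
    have := H.symm a4 a3
    simp only [map_add, LinearMap.add_apply]
    linarith
  refine op_eq_zero D _ fun v hv u hu => ?_
  have hw := sym4_wsp D r1 r2 r3 r4 h1 h2 h3 h4 hu
  by_cases hT : v + (a1 + a2 + a3 + a4) ∈ D.roots
  · rcases hv with rfl | hv
    · rw [zero_add] at hT
      exact absurd hT (not_root H hN)
    · have C : Cfg D.roots B Ψ a1 a2 a3 a4 (v + (a1 + a2 + a3 + a4)) (-v) :=
        ⟨m1, m2, m3, m4, hT, H.neg _ hv, by abel⟩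
      have hu' : u ∈ D.rs (-(-v)) := by rw [neg_neg, ← wsp_root D hv]; exact hu
      rcases cfg_cases H P C with S | S | S | S | S | S
      · exact spl_zero D H P m1 m2 m3 m4 C.mg C.md S h1 h2 h3 h4 hu'
      · rw [sym4_rot, sym4_rot]
        exact spl_zero D H P m3 m4 m1 m2 C.mg C.md S h3 h4 h1 h2 hu'
      · rw [sym4_23]
        exact spl_zero D H P m1 m3 m2 m4 C.mg C.md S h1 h3 h2 h4 hu'
      · rw [sym4_23, sym4_rot, sym4_rot]
        exact spl_zero D H P m2 m4 m1 m3 C.mg C.md S h2 h4 h1 h3 hu'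
      · rw [sym4_34, sym4_23]
        exact spl_zero D H P m1 m4 m2 m3 C.mg C.md S h1 h4 h2 h3 hu'
      · rw [sym4_34, sym4_23, sym4_rot, sym4_rot]
        exact spl_zero D H P m2 m3 m1 m4 C.mg C.md S h2 h3 h1 h4 hu'
  · have h0 : v + (a1 + a2 + a3 + a4) ≠ 0 := by
      intro h0
      have e : a1 + a2 + a3 + a4 = -v := (neg_eq_of_add_eq_zero_right h0).symm
      rw [e] at hN
      rcases hv with rfl | hv
      · simp at hN; linarith
      · exact not_root H hN (H.neg _ hv)
    rw [wsp_bot D hT h0, Submodule.mem_bot] at hw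
    exact hw

lemma sym4_ext (D : LieRootData V L) (X Y Z : Module.End ℂ L)
    (h : ∀ a ∈ Ψ, ∀ x ∈ D.rs a, sym4 (LieAlgebra.ad ℂ L x) X Y Z = 0) :
    ∀ x ∈ D.aSubspace Ψ, sym4 (LieAlgebra.ad ℂ L x) X Y Z = 0 := by
  let K : Submodule ℂ L :=
    { carrier := {x | sym4 (LieAlgebra.ad ℂ L x) X Y Z = 0}
      zero_mem' := by
        show sym4 (LieAlgebra.ad ℂ L 0) X Y Z = 0
        rw [map_zero]; simp [sym4, sym3]
      add_mem' := by
        intro a b ha hb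
        show sym4 (LieAlgebra.ad ℂ L (a + b)) X Y Z = 0
        rw [map_add, sym4_add, ha, hb, add_zero]
      smul_mem' := by
        intro c a ha
        show sym4 (LieAlgebra.ad ℂ L (c • a)) X Y Z = 0
        rw [map_smul, sym4_smul, ha, smul_zero] }
  have : D.aSubspace Ψ ≤ K := iSup₂_le fun a ha x hx => h a ha x hx
  exact fun x hx => this hx

lemma spherical_core (D : LieRootData V L) (H : GoodForm D.roots B) (P : PsiData D.roots B φ Ψ) :
    IsSphericalSubspace (D.aSubspace Ψ) := by
  intro x hx
  have s1 : sym4 (LieAlgebra.ad ℂ L x) (LieAlgebra.ad ℂ L x) (LieAlgebra.ad ℂ L x)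
      (LieAlgebra.ad ℂ L x) = 0 := by
    refine sym4_ext D _ _ _ (fun a1 m1 x1 h1 => ?_) x hx
    rw [sym4_rot]
    refine sym4_ext D _ _ _ (fun a2 m2 x2 h2 => ?_) x hx
    rw [sym4_rot]
    refine sym4_ext D _ _ _ (fun a3 m3 x3 h3 => ?_) x hx
    rw [sym4_rot]
    refine sym4_ext D _ _ _ (fun a4 m4 x4 h4 => ?_) x hx
    exact sym4_zero D H P m4 m1 m2 m3 h4 h1 h2 h3
  rw [sym4_self] at s1
  have : (24 : ℂ) • (LieAlgebra.ad ℂ L x) ^ 4 = 0 := by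
    rw [← s1, show (24 : Module.End ℂ L) = (24 : ℂ) • (1 : Module.End ℂ L) from ?_,
      smul_mul_assoc, one_mul]
    rw [← Algebra.algebraMap_eq_smul_one]
    exact (map_ofNat (algebraMap ℂ (Module.End ℂ L)) 24).symm
  exact (smul_eq_zero.1 this).resolve_left (by norm_num)

lemma psiData_of (D : RootSystemData V) {c : ℝ} (hc : 0 < c)
    (H : GoodForm D.roots (c • innerₗ V)) {φ : V →ₗ[ℝ] ℝ}
    (hφ : ∀ a ∈ D.roots, (a ∈ D.pos ↔ 0 < φ a) ∧ φ a ≠ 0)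
    (hΨ : D.CombIdeal Ψ ∨ D.Biconvex Ψ) (hpos : ∀ α ∈ Ψ, ∀ β ∈ Ψ, 0 ≤ cpair α β) :
    PsiData D.roots (c • innerₗ V) φ Ψ := by
  have hsub : Ψ ⊆ D.pos := hΨ.elim (fun h => h.1) (fun h => h.1)
  refine ⟨fun a ha => D.pos_subset (hsub ha), fun a ha => ?_, fun a ha => (hφ a ha).2,
    fun a ha b hb => ?_, ?_⟩
  · exact (hφ a (D.pos_subset (hsub ha))).1.1 (hsub ha)
  · have h := hpos a ha b hb
    have hb0 : 0 < ⟪b, b⟫ := real_inner_self_pos.2 (D.ne_zero _ (D.pos_subset (hsub hb)))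
    have hab : 0 ≤ ⟪a, b⟫ := by
      unfold cpair at h
      by_contra hn
      have : 2 * ⟪a, b⟫ / ⟪b, b⟫ < 0 := div_neg_of_neg_of_pos (by linarith) hb0
      linarith
    simpa using mul_nonneg hc.le hab
  · rcases hΨ with h | h
    · left
      intro a ha b hb hb0 hab
      have hbp := (hφ b hb).1.2 hb0
      exact h.2 a ha b hbp (D.pos_add a (h.1 ha) b hbp hab)
    · right
      intro a ha b hb d hd hb0 hd0 he
      by_contra hn
      push Not at hn
      have hbp : b ∈ D.pos \ Ψ := ⟨(hφ b hb).1.2 hb0, hn.1⟩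
      have hdp : d ∈ D.pos \ Ψ := ⟨(hφ d hd).1.2 hd0, hn.2⟩
      have ra := D.pos_subset (h.1 ha)
      rcases he with he | he
      · have e : (1 : ℝ) • b + (1 : ℝ) • d = a := by rw [he]; module
        have := h.2.2 b hbp d hdp 1 1 one_pos one_pos (by rw [e]; exact ra)
        rw [e] at this
        exact this.2 ha
      · have e : (1 / 2 : ℝ) • b + (1 / 2 : ℝ) • d = a := by
          rw [← smul_add, ← he]; module
        have := h.2.2 b hbp d hdp (1 / 2) (1 / 2) (by norm_num) (by norm_num) (by rw [e]; exact ra)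
        rw [e] at this
        exact this.2 ha

end Vanish

/-- Suppose `Φ` is irreducible and not of type `G₂`. Let
`Ψ ⊆ Φ⁺` be either a combinatorial ideal or a biconvex subset such that
`⟨α, β⟩ ≥ 0` for all `α, β ∈ Ψ`. Then `𝔞_Ψ = ⊕_{α ∈ Ψ} 𝔤_α` is a spherical
subspace of `𝔫`. -/
theorem spherical_of_pairing_nonneg
    {V : Type*} [NormedAddCommGroup V] [InnerProductSpace ℝ V]
    {L : Type*} [LieRing L] [LieAlgebra ℂ L]
    (D : LieRootData V L)
    (hirr : D.toRootSystemData.IsIrreducible)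
    (hG2 : D.toRootSystemData.NotG2)
    (Ψ : Set V)
    (hΨ : D.toRootSystemData.CombIdeal Ψ ∨ D.toRootSystemData.Biconvex Ψ)
    (hpos : ∀ α ∈ Ψ, ∀ β ∈ Ψ, 0 ≤ cpair α β) :
    IsSphericalSubspace (D.aSubspace Ψ) := by
  obtain ⟨c, hc, H⟩ := exists_goodForm D.toRootSystemData hirr hG2
  obtain ⟨φ, hφ⟩ := exists_phi D.toRootSystemData H
  exact spherical_core D H (psiData_of D.toRootSystemData hc H hφ hΨ hpos)
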